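/- Let F = {f_1, …, f_m} be an injective CPLIFS satisfying the IOSC, with attractor Λ and natural dimension s_F. Then the Hausdorff dimension and the box-counting dimension of Λ exist and are equal, and dim_H Λ = dim_B Λ = s_F. -/

import Mathlib

open Set Filter MeasureTheory Topology

noncomputable section

/-- For a word `w = [i₁, …, iₙ]`, `fw f w = f i₁ ∘ ⋯ ∘ f iₙ`. -/
def fw {m : ℕ} (f : Fin m → ℝ → ℝ) : List (Fin m) → ℝ → ℝ :=
  fun w => w.foldr (fun k g => f k ∘ g) id

/-- `InPiece bk i x` means that `x` belongs to the (closure of the) `i`-th interval of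
linearity determined by the strictly increasing breaking points `bk`. -/
def InPiece {L : ℕ} (bk : Fin L → ℝ) (i : Fin (L + 1)) (x : ℝ) : Prop :=
  (∀ j : Fin L, (j : ℕ) < (i : ℕ) → bk j ≤ x) ∧
  (∀ j : Fin L, (i : ℕ) ≤ (j : ℕ) → x ≤ bk j)

/-- A continuous piecewise linear iterated function system on `ℝ` with `m` maps:
each `f k` has `l k` breaking points `b k 0 < ⋯ < b k (l k - 1)`, is affine with slope
`ρ k i ∈ (-1,1) \ {0}` on the `i`-th interval of linearity, and has distinct slopes on
consecutive intervals. -/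
structure CPLIFS (m : ℕ) where
  f : Fin m → ℝ → ℝ
  l : Fin m → ℕ
  b : (k : Fin m) → Fin (l k) → ℝ
  ρ : (k : Fin m) → Fin (l k + 1) → ℝ
  hm : 2 ≤ m
  hb : ∀ k, StrictMono (b k)
  hρ0 : ∀ k i, ρ k i ≠ 0
  hρ1 : ∀ k i, |ρ k i| < 1
  hρne : ∀ k (i : Fin (l k)), ρ k i.castSucc ≠ ρ k i.succ
  hpiece : ∀ k (i : Fin (l k + 1)) (x y : ℝ),
    InPiece (b k) i x → InPiece (b k) i y → f k x - f k y = ρ k i * (x - y)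

/-- `Λ` is the attractor of `F`: the (unique) nonempty compact set with `Λ = ⋃ₖ f k (Λ)`. -/
def IsAttractor {m : ℕ} (F : CPLIFS m) (Λ : Set ℝ) : Prop :=
  Λ.Nonempty ∧ IsCompact Λ ∧ Λ = ⋃ k, F.f k '' Λ

/-- `c ∈ {1,…,m}^ℕ` is a coding of `x`: the natural projection sends `c` to `x`. -/
def IsCoding {m : ℕ} (F : CPLIFS m) (c : ℕ → Fin m) (x : ℝ) : Prop :=
  ∀ x₀ : ℝ, Tendsto (fun n => fw F.f (List.ofFn fun j : Fin n => c j) x₀) atTop (nhds x)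

/-- `x` is a breaking point of (one of the maps of) `F`. -/
def IsBreakPoint {m : ℕ} (F : CPLIFS m) (x : ℝ) : Prop := ∃ k j, F.b k j = x

/-- Length of the cylinder interval `I_w = f_w([a,b])`. -/
def cylLen {m : ℕ} (f : Fin m → ℝ → ℝ) (a b : ℝ) (w : List (Fin m)) : ℝ :=
  (volume (fw f w '' Icc a b)).toReal

/-- `Σ_{w ∈ {1,…,m}^n} |I_w|^s`. -/
def cylSum {m : ℕ} (f : Fin m → ℝ → ℝ) (a b : ℝ) (n : ℕ) (s : ℝ) : ℝ :=
  ∑ w : Fin n → Fin m, cylLen f a b (List.ofFn w) ^ s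

/-- The natural pressure `Φ^F(s) = limsup_{n→∞} (1/n) log Σ_{w ∈ {1,…,m}^n} |I_w|^s`. -/
def naturalPressure {m : ℕ} (f : Fin m → ℝ → ℝ) (a b : ℝ) (s : ℝ) : ℝ :=
  limsup (fun n : ℕ => (n : ℝ)⁻¹ * Real.log (cylSum f a b n s)) atTop

/-- `[a,b]` is the smallest nonempty compact interval mapped into itself by all maps. -/
def SmallestInvariantInterval {m : ℕ} (f : Fin m → ℝ → ℝ) (a b : ℝ) : Prop :=
  a ≤ b ∧ (∀ k, MapsTo (f k) (Icc a b) (Icc a b)) ∧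
    ∀ a' b' : ℝ, a' ≤ b' → (∀ k, MapsTo (f k) (Icc a' b') (Icc a' b')) →
      Icc a b ⊆ Icc a' b'

/-- `s` is the natural dimension of the system: the unique nonnegative zero of the natural
pressure function. -/
def IsNaturalDim {m : ℕ} (f : Fin m → ℝ → ℝ) (a b : ℝ) (s : ℝ) : Prop :=
  0 ≤ s ∧ naturalPressure f a b s = 0 ∧
    ∀ t : ℝ, 0 ≤ t → naturalPressure f a b t = 0 → t = s

/-- The interval open set condition: the first cylinder intervals `f k ([a,b])` are
pairwise disjoint. -/
def IOSC {m : ℕ} (f : Fin m → ℝ → ℝ) (a b : ℝ) : Prop :=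
  ∀ k k' : Fin m, k ≠ k' → Disjoint (f k '' Icc a b) (f k' '' Icc a b)

/-- `T` is the expanding map associated with the (injective) system `f` on `[a,b]`:
on each first cylinder interval `I_k = f k ([a,b])` it is the inverse of `f k`. -/
def IsExpandingMapOf {m : ℕ} (f : Fin m → ℝ → ℝ) (a b : ℝ) (T : ℝ → ℝ) : Prop :=
  ∀ k, ∀ x ∈ Icc a b, T (f k x) = x

/-- The minimal number of closed `δ`-balls needed to cover `S ⊆ ℝ`. -/
def coverNumber (S : Set ℝ) (δ : ℝ) : ℕ :=
  sInf {n : ℕ | ∃ t : Finset ℝ, t.card = n ∧ S ⊆ ⋃ c ∈ t, Metric.closedBall c δ}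

/-- The upper box-counting (Minkowski) dimension of `S ⊆ ℝ`. -/
def upperBoxDim (S : Set ℝ) : ℝ :=
  limsup (fun δ : ℝ => Real.log (coverNumber S δ) / -Real.log δ) (nhdsWithin 0 (Ioi 0))

/-- The lower box-counting (Minkowski) dimension of `S ⊆ ℝ`. -/
def lowerBoxDim (S : Set ℝ) : ℝ :=
  liminf (fun δ : ℝ => Real.log (coverNumber S δ) / -Real.log δ) (nhdsWithin 0 (Ioi 0))

/-! ### Piecewise linear maps -/

theorem exists_inPiece {L : ℕ} {bk : Fin L → ℝ} (hbk : StrictMono bk) {x y : ℝ}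
    (h : ∀ j, bk j ∉ Ioo x y) :
    ∃ i : Fin (L + 1), ∀ z ∈ Icc x y, InPiece bk i z := by
  classical
  have hex : ∃ i : ℕ, ∀ j : Fin L, i ≤ (j : ℕ) → x < bk j :=
    ⟨L, fun j hj => absurd j.2 (not_lt.mpr hj)⟩
  have hle : Nat.find hex ≤ L :=
    Nat.find_min' hex fun j hj => absurd j.2 (not_lt.mpr hj)
  refine ⟨⟨Nat.find hex, Nat.lt_succ_of_le hle⟩, fun z hz => ⟨fun j hj => ?_, fun j hj => ?_⟩⟩
  · have hnot := Nat.find_min hex hj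
    push Not at hnot
    obtain ⟨j₀, hj₀, hle₀⟩ := hnot
    exact ((hbk.monotone (Fin.le_def.mpr hj₀)).trans hle₀).trans hz.1
  · have hx : x < bk j := Nat.find_spec hex j hj
    by_contra hlt
    exact h j ⟨hx, (not_le.mp hlt).trans_le hz.2⟩

theorem CPLIFS.piece_induction {m : ℕ} (F : CPLIFS m) (k : Fin m) {P : ℝ → ℝ → Prop}
    (htrans : ∀ x y z, x ≤ y → y ≤ z → P x y → P y z → P x z)
    (hP : ∀ i x y, x ≤ y → InPiece (F.b k) i x → InPiece (F.b k) i y → P x y) :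
    ∀ x y, x ≤ y → P x y := by
  classical
  suffices H : ∀ n : ℕ, ∀ x y, x ≤ y →
      (Finset.univ.filter fun j => F.b k j ∈ Ioo x y).card = n → P x y from
    fun x y hxy => H _ x y hxy rfl
  intro n
  induction n using Nat.strong_induction_on with
  | _ n ih =>
    intro x y hxy hn
    by_cases h : ∀ j, F.b k j ∉ Ioo x y
    · obtain ⟨i, hi⟩ := exists_inPiece (F.hb k) h
      exact hP i x y hxy (hi x (left_mem_Icc.mpr hxy)) (hi y (right_mem_Icc.mpr hxy))
    · push Not at h
      obtain ⟨j, hj⟩ := h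
      refine htrans x (F.b k j) y hj.1.le hj.2.le (ih _ ?_ _ _ hj.1.le rfl)
        (ih _ ?_ _ _ hj.2.le rfl)
      · rw [← hn]
        refine Finset.card_lt_card (Finset.ssubset_iff_of_subset ?_ |>.mpr ⟨j, ?_, ?_⟩)
        · intro i hi
          simp only [Finset.mem_filter, Finset.mem_univ, true_and, mem_Ioo] at hi ⊢
          exact ⟨hi.1, hi.2.trans hj.2⟩
        · simpa using hj
        · simp
      · rw [← hn]
        refine Finset.card_lt_card (Finset.ssubset_iff_of_subset ?_ |>.mpr ⟨j, ?_, ?_⟩)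
        · intro i hi
          simp only [Finset.mem_filter, Finset.mem_univ, true_and, mem_Ioo] at hi ⊢
          exact ⟨hj.1.trans hi.1, hi.2⟩
        · simpa using hj
        · simp

theorem CPLIFS.exists_contraction {m : ℕ} (F : CPLIFS m) :
    ∃ R : ℝ, 0 < R ∧ R < 1 ∧ ∀ k x y, |F.f k x - F.f k y| ≤ R * |x - y| := by
  have hm := F.hm
  have : Nonempty ((k : Fin m) × Fin (F.l k + 1)) := ⟨⟨⟨0, by omega⟩, 0⟩⟩
  obtain ⟨q, hq⟩ := Finite.exists_max fun q : (k : Fin m) × Fin (F.l k + 1) => |F.ρ q.1 q.2|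
  refine ⟨|F.ρ q.1 q.2|, abs_pos.mpr (F.hρ0 _ _), F.hρ1 _ _, fun k => ?_⟩
  have H : ∀ x y, x ≤ y → |F.f k x - F.f k y| ≤ |F.ρ q.1 q.2| * (y - x) := by
    refine F.piece_induction k (fun x y z _ _ h₁ h₂ => ?_) (fun i x y hxy hx hy => ?_)
    · calc |F.f k x - F.f k z| ≤ |F.f k x - F.f k y| + |F.f k y - F.f k z| := abs_sub_le _ _ _
        _ ≤ _ := by linarith
    · rw [F.hpiece k i x y hx hy, abs_mul, abs_sub_comm, abs_of_nonneg (sub_nonneg.mpr hxy)]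
      exact mul_le_mul_of_nonneg_right (hq ⟨k, i⟩) (sub_nonneg.mpr hxy)
  intro x y
  rcases le_total x y with h | h
  · rw [abs_sub_comm x y, abs_of_nonneg (sub_nonneg.mpr h)]
    exact H x y h
  · rw [abs_sub_comm (F.f k x), abs_of_nonneg (sub_nonneg.mpr h)]
    exact H y x h

theorem CPLIFS.continuous {m : ℕ} (F : CPLIFS m) (k : Fin m) : Continuous (F.f k) := by
  obtain ⟨R, hR, -, h⟩ := F.exists_contraction
  refine (LipschitzWith.of_dist_le_mul (K := ⟨R, hR.le⟩) fun x y => ?_).continuous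
  rw [Real.dist_eq, Real.dist_eq]
  exact h k x y

theorem CPLIFS.exists_expansion {m : ℕ} (F : CPLIFS m) (hinj : ∀ k, Function.Injective (F.f k)) :
    ∃ r : ℝ, 0 < r ∧ ∀ k x y, r * |x - y| ≤ |F.f k x - F.f k y| := by
  have hm := F.hm
  have : Nonempty ((k : Fin m) × Fin (F.l k + 1)) := ⟨⟨⟨0, by omega⟩, 0⟩⟩
  obtain ⟨q, hq⟩ := Finite.exists_min fun q : (k : Fin m) × Fin (F.l k + 1) => |F.ρ q.1 q.2|
  refine ⟨|F.ρ q.1 q.2|, abs_pos.mpr (F.hρ0 _ _), fun k => ?_⟩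
  have hpc : ∀ i x y, x ≤ y → InPiece (F.b k) i x → InPiece (F.b k) i y →
      |F.ρ q.1 q.2| * (y - x) ≤ |F.f k y - F.f k x| := by
    intro i x y hxy hx hy
    rw [F.hpiece k i y x hy hx, abs_mul, abs_of_nonneg (sub_nonneg.mpr hxy)]
    exact mul_le_mul_of_nonneg_right (hq ⟨k, i⟩) (sub_nonneg.mpr hxy)
  have H : ∀ x y, x ≤ y → |F.ρ q.1 q.2| * (y - x) ≤ |F.f k y - F.f k x| := by
    rcases (F.continuous k).strictMono_of_inj (hinj k) with hmono | hanti
    · have : ∀ x y, x ≤ y → |F.ρ q.1 q.2| * (y - x) ≤ F.f k y - F.f k x := by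
        refine F.piece_induction k (fun x y z _ _ h₁ h₂ => by linarith) fun i x y hxy hx hy => ?_
        have := hpc i x y hxy hx hy
        rwa [abs_of_nonneg (sub_nonneg.mpr (hmono.monotone hxy))] at this
      exact fun x y hxy => (this x y hxy).trans (le_abs_self _)
    · have : ∀ x y, x ≤ y → |F.ρ q.1 q.2| * (y - x) ≤ F.f k x - F.f k y := by
        refine F.piece_induction k (fun x y z _ _ h₁ h₂ => by linarith) fun i x y hxy hx hy => ?_
        have := hpc i x y hxy hx hy
        rwa [abs_sub_comm, abs_of_nonneg (sub_nonneg.mpr (hanti.antitone hxy))] at this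
      exact fun x y hxy => (this x y hxy).trans (abs_sub_comm (F.f k y) _ ▸ le_abs_self _)
  intro x y
  rcases le_total x y with h | h
  · rw [abs_sub_comm x y, abs_of_nonneg (sub_nonneg.mpr h), abs_sub_comm]
    exact H x y h
  · rw [abs_of_nonneg (sub_nonneg.mpr h)]
    exact H y x h

/-- On an interval that contains no breaking point, every map is a similarity. -/
theorem CPLIFS.exists_ratio {m : ℕ} (F : CPLIFS m) (k : Fin m) {c d : ℝ}
    (h : ∀ j, F.b k j ∉ Icc c d) :
    ∃ σ : ℝ, 0 ≤ σ ∧ ∀ x ∈ Icc c d, ∀ y ∈ Icc c d, |F.f k x - F.f k y| = σ * |x - y| := by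
  obtain ⟨i, hi⟩ := exists_inPiece (F.hb k) (x := c) (y := d)
    fun j hj => h j (Ioo_subset_Icc_self hj)
  exact ⟨|F.ρ k i|, abs_nonneg _, fun x hx y hy => by
    rw [F.hpiece k i x y (hi x hx) (hi y hy), abs_mul]⟩

/-! ### Words and cylinder intervals -/

theorem fw_nil {m : ℕ} (f : Fin m → ℝ → ℝ) : fw f [] = id := rfl

theorem fw_cons {m : ℕ} (f : Fin m → ℝ → ℝ) (k : Fin m) (w : List (Fin m)) :
    fw f (k :: w) = f k ∘ fw f w := rfl

theorem fw_append {m : ℕ} (f : Fin m → ℝ → ℝ) (u v : List (Fin m)) :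
    fw f (u ++ v) = fw f u ∘ fw f v := by
  induction u with
  | nil => rfl
  | cons k u ih => rw [List.cons_append, fw_cons, fw_cons, ih, Function.comp_assoc]

theorem fw_mapsTo {m : ℕ} {f : Fin m → ℝ → ℝ} {S : Set ℝ} (h : ∀ k, MapsTo (f k) S S)
    (w : List (Fin m)) : MapsTo (fw f w) S S := by
  induction w with
  | nil => exact mapsTo_id S
  | cons k w ih => exact (h k).comp ih

theorem fw_injective {m : ℕ} {f : Fin m → ℝ → ℝ} (h : ∀ k, Function.Injective (f k))
    (w : List (Fin m)) : Function.Injective (fw f w) := by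
  induction w with
  | nil => exact Function.injective_id
  | cons k w ih => exact (h k).comp ih

theorem fw_continuous {m : ℕ} {f : Fin m → ℝ → ℝ} (h : ∀ k, Continuous (f k))
    (w : List (Fin m)) : Continuous (fw f w) := by
  induction w with
  | nil => exact continuous_id
  | cons k w ih => exact (h k).comp ih

theorem fw_contraction {m : ℕ} {f : Fin m → ℝ → ℝ} {R : ℝ} (hR : 0 ≤ R)
    (h : ∀ k x y, |f k x - f k y| ≤ R * |x - y|) (w : List (Fin m)) (x y : ℝ) :
    |fw f w x - fw f w y| ≤ R ^ w.length * |x - y| := by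
  induction w with
  | nil => simp [fw_nil]
  | cons k w ih =>
    calc |fw f (k :: w) x - fw f (k :: w) y| ≤ R * |fw f w x - fw f w y| := h k _ _
      _ ≤ R * (R ^ w.length * |x - y|) := mul_le_mul_of_nonneg_left ih hR
      _ = R ^ (k :: w).length * |x - y| := by rw [List.length_cons]; ring

theorem fw_expansion {m : ℕ} {f : Fin m → ℝ → ℝ} {r : ℝ} (hr : 0 ≤ r)
    (h : ∀ k x y, r * |x - y| ≤ |f k x - f k y|) (w : List (Fin m)) (x y : ℝ) :
    r ^ w.length * |x - y| ≤ |fw f w x - fw f w y| := by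
  induction w with
  | nil => simp [fw_nil]
  | cons k w ih =>
    calc r ^ (k :: w).length * |x - y| = r * (r ^ w.length * |x - y|) := by
          rw [List.length_cons]; ring
      _ ≤ r * |fw f w x - fw f w y| := mul_le_mul_of_nonneg_left ih hr
      _ ≤ _ := h k _ _

/-- Under the interval open set condition, distinct words of equal length have disjoint
cylinder intervals. -/
theorem eq_of_mem_cylinder {m : ℕ} {f : Fin m → ℝ → ℝ} {a b : ℝ}
    (hinj : ∀ k, Function.Injective (f k)) (hmaps : ∀ k, MapsTo (f k) (Icc a b) (Icc a b))
    (hiosc : IOSC f a b) {u v : List (Fin m)} (hlen : u.length = v.length) {x : ℝ}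
    (hu : x ∈ fw f u '' Icc a b) (hv : x ∈ fw f v '' Icc a b) : u = v := by
  induction u generalizing v x with
  | nil => exact (List.length_eq_zero_iff.mp hlen.symm).symm
  | cons k u ih =>
    cases v with
    | nil => simp at hlen
    | cons k' v =>
      obtain ⟨y, hy, rfl⟩ := hu
      obtain ⟨z, hz, hzy⟩ := hv
      simp only [fw_cons, Function.comp_apply] at hzy
      have hk : k = k' := by
        by_contra hne
        exact disjoint_left.mp (hiosc k k' hne) ⟨_, fw_mapsTo hmaps u hy, rfl⟩
          ⟨_, fw_mapsTo hmaps v hz, hzy⟩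
      subst hk
      rw [ih (by simpa using hlen) ⟨y, hy, rfl⟩ ⟨z, hz, hinj k hzy⟩]

theorem exists_cylinder_eq_Icc {m : ℕ} {f : Fin m → ℝ → ℝ} (h : ∀ k, Continuous (f k)) {a b : ℝ}
    (hab : a ≤ b) (w : List (Fin m)) :
    ∃ c d, c ≤ d ∧ fw f w '' Icc a b = Icc c d ∧ cylLen f a b w = d - c := by
  obtain ⟨c, d, himg⟩ : ∃ c d, fw f w '' Icc a b = Icc c d :=
    ⟨_, _, ContinuousOn.image_Icc hab (fw_continuous h w).continuousOn⟩
  have hne : (fw f w '' Icc a b).Nonempty := (nonempty_Icc.mpr hab).image _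
  have hle := nonempty_Icc.mp (himg ▸ hne)
  refine ⟨c, d, hle, himg, ?_⟩
  rw [cylLen, himg, Real.volume_Icc, ENNReal.toReal_ofReal (sub_nonneg.mpr hle)]

theorem abs_sub_le_cylLen {m : ℕ} {f : Fin m → ℝ → ℝ} (h : ∀ k, Continuous (f k)) {a b : ℝ}
    (hab : a ≤ b) (w : List (Fin m)) {x y : ℝ} (hx : x ∈ fw f w '' Icc a b)
    (hy : y ∈ fw f w '' Icc a b) : |x - y| ≤ cylLen f a b w := by
  obtain ⟨c, d, -, himg, hlen⟩ := exists_cylinder_eq_Icc h hab w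
  rw [himg] at hx hy
  rw [hlen]
  exact abs_sub_le_of_le_of_le hx.1 hx.2 hy.1 hy.2

theorem cylLen_le {m : ℕ} {f : Fin m → ℝ → ℝ} (h : ∀ k, Continuous (f k)) {a b : ℝ}
    (hab : a ≤ b) (w : List (Fin m)) {K : ℝ} (hK : 0 ≤ K)
    (hfw : ∀ x ∈ Icc a b, ∀ y ∈ Icc a b, |fw f w x - fw f w y| ≤ K * |x - y|) :
    cylLen f a b w ≤ K * (b - a) := by
  obtain ⟨c, d, hcd, himg, hlen⟩ := exists_cylinder_eq_Icc h hab w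
  obtain ⟨x, hx, rfl⟩ : c ∈ fw f w '' Icc a b := himg ▸ left_mem_Icc.mpr hcd
  obtain ⟨y, hy, rfl⟩ : d ∈ fw f w '' Icc a b := himg ▸ right_mem_Icc.mpr hcd
  rw [hlen]
  exact (le_abs_self _).trans ((hfw y hy x hx).trans
    (mul_le_mul_of_nonneg_left (abs_sub_le_of_le_of_le hy.1 hy.2 hx.1 hx.2) hK))

theorem cylLen_nonneg {m : ℕ} (f : Fin m → ℝ → ℝ) (a b : ℝ) (w : List (Fin m)) :
    0 ≤ cylLen f a b w := ENNReal.toReal_nonneg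

/-- The finite set of words of length `n` over `Fin m`. -/
def words (m n : ℕ) : Finset (List (Fin m)) :=
  (Finset.univ : Finset (Fin n → Fin m)).map ⟨List.ofFn, List.ofFn_injective⟩

theorem mem_words {m n : ℕ} {w : List (Fin m)} : w ∈ words m n ↔ w.length = n := by
  simp only [words, Finset.mem_map, Finset.mem_univ, true_and, Function.Embedding.coeFn_mk]
  constructor
  · rintro ⟨g, rfl⟩
    exact List.length_ofFn
  · rintro rfl
    exact ⟨w.get, List.ofFn_get w⟩

theorem card_words (m n : ℕ) : (words m n).card = m ^ n := by
  simp [words]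

theorem cylSum_eq_sum_words {m : ℕ} (f : Fin m → ℝ → ℝ) (a b : ℝ) (n : ℕ) (s : ℝ) :
    cylSum f a b n s = ∑ w ∈ words m n, cylLen f a b w ^ s := by
  simp [words, cylSum]

/-! ### Lipschitz constants and first return loops -/

/-- The optimal Lipschitz constant of `g` on `S`. -/
def lipOn (g : ℝ → ℝ) (S : Set ℝ) : ℝ :=
  sInf {K : ℝ | 0 ≤ K ∧ ∀ x ∈ S, ∀ y ∈ S, |g x - g y| ≤ K * |x - y|}

theorem lipOn_nonneg (g : ℝ → ℝ) (S : Set ℝ) : 0 ≤ lipOn g S :=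
  Real.sInf_nonneg fun _ hK => hK.1

theorem lipOn_le {g : ℝ → ℝ} {S : Set ℝ} {K : ℝ} (hK : 0 ≤ K)
    (h : ∀ x ∈ S, ∀ y ∈ S, |g x - g y| ≤ K * |x - y|) : lipOn g S ≤ K :=
  csInf_le ⟨0, fun _ hK' => hK'.1⟩ ⟨hK, h⟩

theorem abs_sub_le_lipOn {g : ℝ → ℝ} {S : Set ℝ} {K : ℝ} (hK : 0 ≤ K)
    (h : ∀ x ∈ S, ∀ y ∈ S, |g x - g y| ≤ K * |x - y|) {x y : ℝ} (hx : x ∈ S) (hy : y ∈ S) :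
    |g x - g y| ≤ lipOn g S * |x - y| := by
  rcases eq_or_ne x y with rfl | hne
  · simp
  · have hpos : 0 < |x - y| := abs_pos.mpr (sub_ne_zero.mpr hne)
    rw [← div_le_iff₀ hpos]
    exact le_csInf ⟨K, hK, h⟩ fun K' hK' => (div_le_iff₀ hpos).mpr (hK'.2 x hx y hy)

theorem abs_sub_eq_lipOn {g : ℝ → ℝ} {S : Set ℝ} {σ : ℝ} (hσ : 0 ≤ σ)
    (h : ∀ x ∈ S, ∀ y ∈ S, |g x - g y| = σ * |x - y|) {x y : ℝ} (hx : x ∈ S) (hy : y ∈ S) :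
    |g x - g y| = lipOn g S * |x - y| := by
  have h' : ∀ x ∈ S, ∀ y ∈ S, |g x - g y| ≤ σ * |x - y| := fun x hx y hy => (h x hx y hy).le
  refine le_antisymm (abs_sub_le_lipOn hσ h' hx hy) ?_
  rw [h x hx y hy]
  exact mul_le_mul_of_nonneg_right (lipOn_le hσ h') (abs_nonneg _)

theorem sum_le_sum_of_exists_preimage {α β : Type*} (S : Finset α) (T : Finset β) (φ : β → α)
    {A : α → ℝ} {B : β → ℝ} (hB : ∀ t ∈ T, 0 ≤ B t)
    (h : ∀ w ∈ S, ∃ t ∈ T, φ t = w ∧ A w ≤ B t) : ∑ w ∈ S, A w ≤ ∑ t ∈ T, B t := by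
  classical
  rcases S.eq_empty_or_nonempty with rfl | ⟨w₀, hw₀⟩
  · simpa using Finset.sum_nonneg hB
  have : Nonempty β := ⟨(h w₀ hw₀).choose⟩
  choose! c hcT hcφ hc using h
  have hinj : Set.InjOn c S := fun x hx y hy hxy => by rw [← hcφ x hx, ← hcφ y hy, hxy]
  calc ∑ w ∈ S, A w ≤ ∑ w ∈ S, B (c w) := Finset.sum_le_sum hc
    _ = ∑ t ∈ S.image c, B t := (Finset.sum_image hinj).symm
    _ ≤ ∑ t ∈ T, B t := Finset.sum_le_sum_of_subset_of_nonneg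
        (Finset.image_subset_iff.mpr hcT) fun t ht _ => hB t ht

open Classical in
/-- Words `g` of length `n` for which `fw f g` maps the cylinder interval of `v` into itself
as a similarity. -/
def loops {m : ℕ} (f : Fin m → ℝ → ℝ) (a b : ℝ) (v : List (Fin m)) (n : ℕ) :
    Finset (List (Fin m)) :=
  (words m n).filter fun g => v <+: g ++ v ∧
    ∀ x ∈ fw f v '' Icc a b, ∀ y ∈ fw f v '' Icc a b,
      |fw f g x - fw f g y| = lipOn (fw f g) (fw f v '' Icc a b) * |x - y|

open Classical in
/-- Words of length `n` whose cylinder interval contains a breaking point. -/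
def badWords {m : ℕ} (F : CPLIFS m) (a b : ℝ) (n : ℕ) : Finset (List (Fin m)) :=
  (words m n).filter fun u => ∃ x, IsBreakPoint F x ∧ x ∈ fw F.f u '' Icc a b

open Classical in
/-- Words of length `n` none of whose subwords lies in `E`. -/
def avoiding {m : ℕ} (E : Finset (List (Fin m))) (n : ℕ) : Finset (List (Fin m)) :=
  (words m n).filter fun w => ∀ e ∈ E, ¬ e <:+: w

/-- The partition sum over words avoiding `E`. -/
def avoidSum {m : ℕ} (f : Fin m → ℝ → ℝ) (a b s : ℝ) (E : Finset (List (Fin m))) (n : ℕ) : ℝ :=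
  ∑ w ∈ avoiding E n, lipOn (fw f w) (Icc a b) ^ s

theorem avoidSum_nonneg {m : ℕ} (f : Fin m → ℝ → ℝ) (a b s : ℝ) (E : Finset (List (Fin m)))
    (n : ℕ) : 0 ≤ avoidSum f a b s E n :=
  Finset.sum_nonneg fun _ _ => Real.rpow_nonneg (lipOn_nonneg _ _) _

theorem card_badWords_le {m : ℕ} (F : CPLIFS m) (hinj : ∀ k, Function.Injective (F.f k)) {a b : ℝ}
    (hmaps : ∀ k, MapsTo (F.f k) (Icc a b) (Icc a b)) (hiosc : IOSC F.f a b) (n : ℕ) :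
    (badWords F a b n).card ≤ Fintype.card ((k : Fin m) × Fin (F.l k)) := by
  classical
  have h : ∀ u ∈ badWords F a b n, ∃ q : (k : Fin m) × Fin (F.l k),
      F.b q.1 q.2 ∈ fw F.f u '' Icc a b := by
    intro u hu
    obtain ⟨-, x, ⟨k, j, rfl⟩, hx⟩ := Finset.mem_filter.mp hu
    exact ⟨⟨k, j⟩, hx⟩
  rcases (badWords F a b n).eq_empty_or_nonempty with hempty | ⟨u₀, hu₀⟩
  · simp [hempty]
  have : Nonempty ((k : Fin m) × Fin (F.l k)) := ⟨(h u₀ hu₀).choose⟩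
  choose! c hc using h
  refine Finset.card_le_card_of_injOn c (fun _ _ => Finset.mem_coe.mpr (Finset.mem_univ _))
    fun u hu v hv huv => ?_
  have hlen : u.length = v.length :=
    (mem_words.mp (Finset.mem_filter.mp hu).1).trans (mem_words.mp (Finset.mem_filter.mp hv).1).symm
  exact eq_of_mem_cylinder hinj hmaps hiosc hlen (hc u hu) (huv ▸ hc v hv)

/-- If no suffix of `g ++ v` extending `v` has a cylinder interval containing a breaking point,
then `fw F.f g` is a similarity on the cylinder interval of `v`. -/
theorem exists_ratio_of_no_breakPoint {m : ℕ} (F : CPLIFS m) {a b : ℝ} (hab : a ≤ b)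
    (v g : List (Fin m))
    (h : ∀ t, t <:+ g → ∀ x, IsBreakPoint F x → x ∉ fw F.f (t ++ v) '' Icc a b) :
    ∃ σ : ℝ, 0 ≤ σ ∧ ∀ x ∈ fw F.f v '' Icc a b, ∀ y ∈ fw F.f v '' Icc a b,
      |fw F.f g x - fw F.f g y| = σ * |x - y| := by
  induction g with
  | nil => exact ⟨1, zero_le_one, fun x _ y _ => by simp [fw_nil]⟩
  | cons k g ih =>
    obtain ⟨σ, hσ, hsim⟩ := ih fun t ht => h t (ht.trans (List.suffix_cons k g))
    obtain ⟨c, d, -, himg, -⟩ := exists_cylinder_eq_Icc F.continuous hab (g ++ v)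
    obtain ⟨τ, hτ, hsim'⟩ := F.exists_ratio k (c := c) (d := d) fun j hj =>
      h g (List.suffix_cons k g) _ ⟨k, j, rfl⟩ (himg ▸ hj)
    have hmem : ∀ x ∈ fw F.f v '' Icc a b, fw F.f g x ∈ Icc c d := by
      rintro _ ⟨x, hx, rfl⟩
      rw [← himg, fw_append]
      exact ⟨x, hx, rfl⟩
    refine ⟨τ * σ, mul_nonneg hτ hσ, fun x hx y hy => ?_⟩
    rw [fw_cons, Function.comp_apply, Function.comp_apply, hsim' _ (hmem x hx) _ (hmem y hy),
      hsim x hx y hy, mul_assoc]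

section PartitionSum

variable {m : ℕ} {F : CPLIFS m} {a b R : ℝ}

theorem lipOn_fw_le_pow (hR : 0 ≤ R) (hlip : ∀ k x y, |F.f k x - F.f k y| ≤ R * |x - y|)
    (w : List (Fin m)) (S : Set ℝ) : lipOn (fw F.f w) S ≤ R ^ w.length :=
  lipOn_le (pow_nonneg hR _) fun x _ y _ => fw_contraction hR hlip w x y

theorem lipOn_fw_append_le (hR : 0 ≤ R) (hlip : ∀ k x y, |F.f k x - F.f k y| ≤ R * |x - y|)
    (hmaps : ∀ k, MapsTo (F.f k) (Icc a b) (Icc a b)) (x g v : List (Fin m)) :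
    lipOn (fw F.f (x ++ g ++ v)) (Icc a b) ≤
      lipOn (fw F.f x) (Icc a b) * lipOn (fw F.f g) (fw F.f v '' Icc a b) * R ^ v.length := by
  have hbd : ∀ (w : List (Fin m)) (S : Set ℝ), ∀ y ∈ S, ∀ z ∈ S,
      |fw F.f w y - fw F.f w z| ≤ R ^ w.length * |y - z| :=
    fun w S y _ z _ => fw_contraction hR hlip w y z
  refine lipOn_le (mul_nonneg (mul_nonneg (lipOn_nonneg _ _) (lipOn_nonneg _ _))
    (pow_nonneg hR _)) fun y hy z hz => ?_
  have hv := fw_mapsTo hmaps v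
  have hg := fw_mapsTo hmaps g
  rw [fw_append, fw_append]
  simp only [Function.comp_apply]
  calc _ ≤ lipOn (fw F.f x) (Icc a b) * |fw F.f g (fw F.f v y) - fw F.f g (fw F.f v z)| :=
        abs_sub_le_lipOn (pow_nonneg hR _) (hbd x _) (hg (hv hy)) (hg (hv hz))
    _ ≤ lipOn (fw F.f x) (Icc a b) * (lipOn (fw F.f g) (fw F.f v '' Icc a b) *
        (R ^ v.length * |y - z|)) := by
        refine mul_le_mul_of_nonneg_left ?_ (lipOn_nonneg _ _)
        exact (abs_sub_le_lipOn (pow_nonneg hR _) (hbd g _) (mem_image_of_mem _ hy)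
          (mem_image_of_mem _ hz)).trans (mul_le_mul_of_nonneg_left
            (fw_contraction hR hlip v y z) (lipOn_nonneg _ _))
    _ = _ := by ring

theorem avoiding_take {E : Finset (List (Fin m))} {n i : ℕ} {w : List (Fin m)}
    (hw : w ∈ avoiding E n) (hi : i ≤ n) : w.take i ∈ avoiding E i := by
  classical
  obtain ⟨hlen, hE⟩ := Finset.mem_filter.mp hw
  refine Finset.mem_filter.mpr ⟨mem_words.mpr ?_, fun e he hinf => hE e he
    (hinf.trans (List.take_prefix i w).isInfix)⟩
  rw [List.length_take, mem_words.mp hlen, min_eq_left hi]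

/-- Decomposition of a word according to its longest first return loop or a suffix whose cylinder
interval contains a breaking point. -/
theorem exists_decomposition (hab : a ≤ b) {E : Finset (List (Fin m))} {n p : ℕ} (hp : 1 ≤ p)
    (hpn : p ≤ n) {w : List (Fin m)} (hw : w ∈ avoiding E n) :
    (∃ q ∈ Finset.Icc p n, ∃ x ∈ avoiding E (n - q), ∃ u ∈ badWords F a b q, x ++ u = w) ∨
    ∃ v ∈ words m p \ E, ∃ i ∈ Finset.range (n + 1), ∃ x ∈ avoiding (insert v E) i,
      ∃ g ∈ loops F.f a b v (n - p - i), x ++ g ++ v = w := by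
  classical
  obtain ⟨hlen, hE⟩ := Finset.mem_filter.mp hw
  rw [mem_words] at hlen
  by_cases hbad : ∃ q ∈ Finset.Icc p n, w.drop (n - q) ∈ badWords F a b q
  · obtain ⟨q, hq, hu⟩ := hbad
    exact Or.inl ⟨q, hq, w.take (n - q), avoiding_take hw (Nat.sub_le _ _), _, hu,
      List.take_append_drop _ _⟩
  · right
    push Not at hbad
    set v := w.drop (n - p) with hv
    have hvlen : v.length = p := by rw [hv, List.length_drop]; omega
    have hex : ∃ i, v <+: w.drop i := ⟨n - p, List.prefix_refl _⟩
    set i := Nat.find hex with hi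
    have hile : i ≤ n - p := Nat.find_min' hex (List.prefix_refl _)
    set g := (w.drop i).take (n - p - i) with hg
    have hgv : g ++ v = w.drop i := by
      rw [hg, hv]
      conv_rhs => rw [← List.take_append_drop (n - p - i) (w.drop i)]
      rw [List.drop_drop]
      congr 2
      omega
    have hglen : g.length = n - p - i := by
      rw [hg, List.length_take, List.length_drop]; omega
    have hsum : w.take i ++ g ++ v = w := by
      rw [List.append_assoc, hgv, List.take_append_drop]
    refine ⟨v, Finset.mem_sdiff.mpr ⟨mem_words.mpr hvlen, fun hvE =>
        hE v hvE (List.drop_suffix _ _).isInfix⟩, i, Finset.mem_range.mpr (by omega),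
      w.take i, ?_, g, ?_, hsum⟩
    · have hx := avoiding_take hw (show i ≤ n by omega)
      obtain ⟨hxlen, hxE⟩ := Finset.mem_filter.mp hx
      refine Finset.mem_filter.mpr ⟨hxlen, fun e he => ?_⟩
      rcases Finset.mem_insert.mp he with rfl | he
      · rintro ⟨s, t, hst⟩
        have hs : s.length < i := by
          have := congrArg List.length hst
          rw [List.length_append, List.length_append, hvlen, mem_words.mp hxlen] at this
          omega
        refine Nat.find_min hex hs ⟨t ++ w.drop i, ?_⟩
        have : w = s ++ (v ++ (t ++ w.drop i)) := by
          conv_lhs => rw [← List.take_append_drop i w, ← hst]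
          simp only [List.append_assoc]
        conv_rhs => rw [this]
        rw [List.drop_left]
      · exact hxE e he
    · obtain ⟨σ, hσ, hsim⟩ := exists_ratio_of_no_breakPoint F hab v g (by
        intro t ht x hx hmem
        have htlen := ht.length_le
        refine hbad (t ++ v).length (Finset.mem_Icc.mpr ⟨?_, ?_⟩) ?_
        · rw [List.length_append, hvlen]; omega
        · rw [List.length_append, hvlen]; omega
        · have hsuf : t ++ v <:+ w := by
            obtain ⟨t', ht'⟩ := ht
            refine ⟨w.take i ++ t', Eq.trans ?_ hsum⟩
            rw [← ht']
            simp only [List.append_assoc]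
          rw [← hlen, ← List.suffix_iff_eq_drop.mp hsuf]
          exact Finset.mem_filter.mpr ⟨mem_words.mpr rfl, x, hx, hmem⟩)
      refine Finset.mem_filter.mpr ⟨mem_words.mpr hglen, ?_, fun x hx y hy =>
        abs_sub_eq_lipOn hσ hsim hx hy⟩
      rw [hgv]
      exact Nat.find_spec hex

theorem avoidSum_le_recursion (hab : a ≤ b) (hR : 0 ≤ R) (hR1 : R < 1)
    (hlip : ∀ k x y, |F.f k x - F.f k y| ≤ R * |x - y|)
    (hinj : ∀ k, Function.Injective (F.f k))
    (hmaps : ∀ k, MapsTo (F.f k) (Icc a b) (Icc a b)) (hiosc : IOSC F.f a b)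
    {s : ℝ} (hs : 0 < s) {p : ℕ} (hp : 1 ≤ p)
    (hloops : ∀ v ∈ words m p, ∀ n,
      ∑ g ∈ loops F.f a b v n, lipOn (fw F.f g) (fw F.f v '' Icc a b) ^ s ≤ 1)
    (E : Finset (List (Fin m))) {n : ℕ} (hpn : p ≤ n) :
    avoidSum F.f a b s E n ≤
      ∑ q ∈ Finset.Icc p n, Fintype.card ((k : Fin m) × Fin (F.l k)) * (R ^ s) ^ q *
        avoidSum F.f a b s E (n - q) +
      ∑ v ∈ words m p \ E, ∑ i ∈ Finset.range (n + 1), avoidSum F.f a b s (insert v E) i := by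
  classical
  have hnn : ∀ (w : List (Fin m)) (S : Set ℝ), 0 ≤ lipOn (fw F.f w) S ^ s :=
    fun w S => Real.rpow_nonneg (lipOn_nonneg _ _) _
  have hRs : 0 ≤ R ^ s := Real.rpow_nonneg hR s
  set P : List (Fin m) → Prop := fun w =>
    ∃ q ∈ Finset.Icc p n, ∃ x ∈ avoiding E (n - q), ∃ u ∈ badWords F a b q, x ++ u = w
  rw [avoidSum, ← Finset.sum_filter_add_sum_filter_not _ P]
  refine add_le_add ?_ ?_
  · calc _ ≤ ∑ t ∈ (Finset.Icc p n).sigma fun q => avoiding E (n - q) ×ˢ badWords F a b q,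
          lipOn (fw F.f t.2.1) (Icc a b) ^ s * (R ^ s) ^ t.1 := by
          refine sum_le_sum_of_exists_preimage _ _ (fun t => t.2.1 ++ t.2.2)
            (fun t _ => mul_nonneg (hnn _ _) (pow_nonneg hRs _)) fun w hw => ?_
          obtain ⟨-, q, hq, x, hx, u, hu, rfl⟩ := Finset.mem_filter.mp hw
          refine ⟨⟨q, x, u⟩, Finset.mem_sigma.mpr ⟨hq, Finset.mem_product.mpr ⟨hx, hu⟩⟩, rfl, ?_⟩
          have hlen := mem_words.mp (Finset.mem_filter.mp hu).1
          have h := lipOn_fw_append_le hR hlip hmaps x [] u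
          have h1 : lipOn (fw F.f []) (fw F.f u '' Icc a b) ≤ 1 := by
            simpa using lipOn_fw_le_pow hR hlip [] (fw F.f u '' Icc a b)
          rw [List.append_nil, hlen] at h
          have h2 : lipOn (fw F.f (x ++ u)) (Icc a b) ≤ lipOn (fw F.f x) (Icc a b) * R ^ q := by
            refine h.trans (mul_le_mul_of_nonneg_right ?_ (pow_nonneg hR _))
            exact mul_le_of_le_one_right (lipOn_nonneg _ _) h1
          calc _ ≤ (lipOn (fw F.f x) (Icc a b) * R ^ q) ^ s :=
                Real.rpow_le_rpow (lipOn_nonneg _ _) h2 hs.le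
            _ = _ := by
                rw [Real.mul_rpow (lipOn_nonneg _ _) (pow_nonneg hR _), ← Real.rpow_natCast,
                  ← Real.rpow_natCast, ← Real.rpow_mul hR, ← Real.rpow_mul hR, mul_comm s]
      _ ≤ _ := by
          rw [Finset.sum_sigma]
          refine Finset.sum_le_sum fun q _ => ?_
          rw [Finset.sum_product]
          simp only [Finset.sum_const, nsmul_eq_mul]
          rw [← Finset.mul_sum, ← Finset.sum_mul, mul_assoc, mul_comm ((R ^ s) ^ q)]
          refine mul_le_mul_of_nonneg_right ?_
            (mul_nonneg (avoidSum_nonneg _ _ _ _ _ _) (pow_nonneg hRs _))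
          exact_mod_cast card_badWords_le F hinj hmaps hiosc q
  · calc _ ≤ ∑ t ∈ (words m p \ E).sigma fun v => (Finset.range (n + 1)).sigma fun i =>
          avoiding (insert v E) i ×ˢ loops F.f a b v (n - p - i),
          lipOn (fw F.f t.2.2.1) (Icc a b) ^ s *
            lipOn (fw F.f t.2.2.2) (fw F.f t.1 '' Icc a b) ^ s := by
          refine sum_le_sum_of_exists_preimage _ _ (fun t => t.2.2.1 ++ t.2.2.2 ++ t.1)
            (fun t _ => mul_nonneg (hnn _ _) (hnn _ _)) fun w hw => ?_
          obtain ⟨hw, hnot⟩ := Finset.mem_filter.mp hw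
          obtain ⟨v, hv, i, hi, x, hx, g, hg, rfl⟩ :=
            (exists_decomposition (F := F) hab hp hpn hw).resolve_left hnot
          refine ⟨⟨v, i, x, g⟩, Finset.mem_sigma.mpr ⟨hv, Finset.mem_sigma.mpr
            ⟨hi, Finset.mem_product.mpr ⟨hx, hg⟩⟩⟩, rfl, ?_⟩
          rw [← Real.mul_rpow (lipOn_nonneg _ _) (lipOn_nonneg _ _)]
          refine Real.rpow_le_rpow (lipOn_nonneg _ _) ?_ hs.le
          refine (lipOn_fw_append_le hR hlip hmaps x g v).trans ?_
          exact mul_le_of_le_one_right (mul_nonneg (lipOn_nonneg _ _) (lipOn_nonneg _ _))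
            (pow_le_one₀ hR hR1.le)
      _ ≤ _ := by
          rw [Finset.sum_sigma]
          refine Finset.sum_le_sum fun v hv => ?_
          rw [Finset.sum_sigma]
          refine Finset.sum_le_sum fun i _ => ?_
          rw [Finset.sum_product]
          simp only
          refine Finset.sum_le_sum fun x _ => ?_
          rw [← Finset.mul_sum]
          exact mul_le_of_le_one_right (hnn _ _)
            (hloops v (Finset.mem_sdiff.mp hv).1 _)

/-- If the loop sums at all words of length `p` are at most one, then the partition sums grow
more slowly than any exponential. -/
theorem exists_avoidSum_le (hab : a ≤ b) (hR : 0 ≤ R) (hR1 : R < 1)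
    (hlip : ∀ k x y, |F.f k x - F.f k y| ≤ R * |x - y|)
    (hinj : ∀ k, Function.Injective (F.f k))
    (hmaps : ∀ k, MapsTo (F.f k) (Icc a b) (Icc a b)) (hiosc : IOSC F.f a b)
    {s : ℝ} (hs : 0 < s) {p : ℕ} (hp : 1 ≤ p)
    (hpR : Fintype.card ((k : Fin m) × Fin (F.l k)) * ((R ^ s) ^ p / (1 - R ^ s)) ≤ 1 / 2)
    (hloops : ∀ v ∈ words m p, ∀ n,
      ∑ g ∈ loops F.f a b v n, lipOn (fw F.f g) (fw F.f v '' Icc a b) ^ s ≤ 1)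
    {μ : ℝ} (hμ : 1 < μ) (E : Finset (List (Fin m))) :
    ∃ C : ℝ, 0 ≤ C ∧ ∀ n, avoidSum F.f a b s E n ≤ C * μ ^ n := by
  classical
  have hRs : 0 ≤ R ^ s := Real.rpow_nonneg hR s
  have hRs1 : R ^ s < 1 := Real.rpow_lt_one hR hR1 hs
  induction hN : (words m p \ E).card using Nat.strong_induction_on generalizing E with
  | _ N ih =>
    have hstep : ∀ v, ∃ C : ℝ, 0 ≤ C ∧ (v ∈ words m p \ E →
        ∀ n, avoidSum F.f a b s (insert v E) n ≤ C * μ ^ n) := by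
      intro v
      by_cases hv : v ∈ words m p \ E
      · obtain ⟨C, hC, h⟩ := ih _ (by
          rw [← hN]
          refine Finset.card_lt_card (Finset.ssubset_iff_of_subset ?_ |>.mpr ⟨v, hv, by simp⟩)
          exact Finset.sdiff_subset_sdiff le_rfl (Finset.subset_insert v E)) (insert v E) rfl
        exact ⟨C, hC, fun _ => h⟩
      · exact ⟨0, le_rfl, fun h => absurd h hv⟩
    choose D hD0 hD using hstep
    set M : ℝ := ∑ v ∈ words m p \ E, D v * (μ / (μ - 1)) with hM
    have hμ1 : 0 < μ - 1 := by linarith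
    have hM0 : 0 ≤ M := Finset.sum_nonneg fun v _ =>
      mul_nonneg (hD0 v) (div_nonneg (by linarith) hμ1.le)
    refine ⟨(m : ℝ) ^ p + 2 * M, by positivity, fun n => ?_⟩
    set C : ℝ := (m : ℝ) ^ p + 2 * M with hC
    have hC0 : 0 ≤ C := by positivity
    have hm1 : (1 : ℝ) ≤ m := by
      have := F.hm
      exact_mod_cast (by omega : 1 ≤ m)
    induction n using Nat.strong_induction_on with
    | _ n ihn =>
      rcases lt_or_ge n p with hn | hn
      · calc avoidSum F.f a b s E n ≤ ∑ w ∈ avoiding E n, (1 : ℝ) :=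
              Finset.sum_le_sum fun w _ => Real.rpow_le_one (lipOn_nonneg _ _)
                ((lipOn_fw_le_pow hR hlip w _).trans (pow_le_one₀ hR hR1.le)) hs.le
          _ ≤ ((words m n).card : ℝ) := by
              rw [Finset.sum_const, nsmul_eq_mul, mul_one]
              exact_mod_cast Finset.card_le_card (Finset.filter_subset _ _)
          _ = (m : ℝ) ^ n := by rw [card_words]; push_cast; rfl
          _ ≤ (m : ℝ) ^ p := pow_le_pow_right₀ hm1 hn.le
          _ ≤ C := by linarith
          _ ≤ C * μ ^ n := le_mul_of_one_le_right hC0 (one_le_pow₀ hμ.le)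
      · have hμn : 0 < μ ^ n := by positivity
        refine (avoidSum_le_recursion hab hR hR1 hlip hinj hmaps hiosc hs hp hloops E hn).trans ?_
        have h1 : ∑ q ∈ Finset.Icc p n, Fintype.card ((k : Fin m) × Fin (F.l k)) * (R ^ s) ^ q *
            avoidSum F.f a b s E (n - q) ≤ 1 / 2 * (C * μ ^ n) := by
          calc _ ≤ ∑ q ∈ Finset.Icc p n, (Fintype.card ((k : Fin m) × Fin (F.l k)) : ℝ) *
                (R ^ s) ^ q * (C * μ ^ n) := by
                refine Finset.sum_le_sum fun q hq => mul_le_mul_of_nonneg_left ?_ (by positivity)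
                have hq' := Finset.mem_Icc.mp hq
                exact (ihn (n - q) (by omega)).trans (mul_le_mul_of_nonneg_left
                  (pow_le_pow_right₀ hμ.le (Nat.sub_le _ _)) hC0)
            _ = Fintype.card ((k : Fin m) × Fin (F.l k)) *
                (∑ q ∈ Finset.Icc p n, (R ^ s) ^ q) * (C * μ ^ n) := by
                rw [Finset.mul_sum, Finset.sum_mul]
            _ ≤ 1 / 2 * (C * μ ^ n) := by
                refine mul_le_mul_of_nonneg_right (le_trans ?_ hpR) (by positivity)
                refine mul_le_mul_of_nonneg_left ?_ (by positivity)
                rw [← Finset.Ico_add_one_right_eq_Icc]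
                exact geom_sum_Ico_le_of_lt_one hRs hRs1
        have h2 : ∑ v ∈ words m p \ E, ∑ i ∈ Finset.range (n + 1),
            avoidSum F.f a b s (insert v E) i ≤ M * μ ^ n := by
          rw [hM, Finset.sum_mul]
          refine Finset.sum_le_sum fun v hv => ?_
          calc _ ≤ ∑ i ∈ Finset.range (n + 1), D v * μ ^ i :=
                Finset.sum_le_sum fun i _ => hD v hv i
            _ = D v * ((μ ^ (n + 1) - 1) / (μ - 1)) := by
                rw [← Finset.mul_sum, geom_sum_eq hμ.ne']
            _ ≤ D v * (μ ^ (n + 1) / (μ - 1)) := by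
                refine mul_le_mul_of_nonneg_left ?_ (hD0 v)
                exact div_le_div_of_nonneg_right (by linarith) hμ1.le
            _ = D v * (μ / (μ - 1)) * μ ^ n := by rw [pow_succ]; ring
        have h3 : 2 * M * μ ^ n ≤ C * μ ^ n := by
          refine mul_le_mul_of_nonneg_right ?_ hμn.le
          have : (0 : ℝ) ≤ (m : ℝ) ^ p := by positivity
          linarith
        linarith

end PartitionSum

/-! ### Finite covers of sets invariant under disjoint expanding-from-below maps -/

theorem le_sum_rpow_of_cover {ι κ : Type*} {G : Finset ι} {φ : ι → ℝ → ℝ} {r : ι → ℝ} {K : Set ℝ}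
    {c s : ℝ} (hs : 0 < s) (hc : 0 < c) (hK : K.Nonempty) (hG : 1 < G.card)
    (hr : ∀ i ∈ G, 0 < r i) (hφ : ∀ i ∈ G, MapsTo (φ i) K K)
    (hexp : ∀ i ∈ G, ∀ x ∈ K, ∀ y ∈ K, r i * |x - y| ≤ |φ i x - φ i y|)
    (hsep : ∀ i ∈ G, ∀ j ∈ G, i ≠ j → ∀ x ∈ K, ∀ y ∈ K, c ≤ |φ i x - φ j y|)
    (hsum : 1 ≤ ∑ i ∈ G, r i ^ s) (T : Finset κ) (U : κ → Set ℝ) (d : κ → ℝ)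
    (hd : ∀ j ∈ T, 0 ≤ d j) (hU : ∀ j ∈ T, ∀ x ∈ U j ∩ K, ∀ y ∈ U j ∩ K, |x - y| ≤ d j)
    (hcov : K ⊆ ⋃ j ∈ T, U j) : c ^ s ≤ ∑ j ∈ T, d j ^ s := by
  classical
  induction hN : T.card using Nat.strong_induction_on generalizing T U d with
  | _ N ih =>
    by_cases hbig : ∃ j ∈ T, c ≤ d j
    · obtain ⟨j, hj, hcj⟩ := hbig
      exact (Real.rpow_le_rpow hc.le hcj hs.le).trans
        (Finset.single_le_sum (f := fun j => d j ^ s)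
          (fun i hi => Real.rpow_nonneg (hd i hi) s) hj)
    · push Not at hbig
      set S : ι → Finset κ := fun i => T.filter fun j => ∃ x ∈ K, φ i x ∈ U j with hS
      have hdisj : ∀ i ∈ G, ∀ i' ∈ G, i ≠ i' → Disjoint (S i) (S i') := by
        intro i hi i' hi' hne
        rw [Finset.disjoint_left]
        intro j hj hj'
        obtain ⟨hjT, x, hx, hxU⟩ := Finset.mem_filter.mp hj
        obtain ⟨-, y, hy, hyU⟩ := Finset.mem_filter.mp hj'
        exact absurd ((hsep i hi i' hi' hne x hx y hy).trans
          (hU j hjT _ ⟨hxU, hφ i hi hx⟩ _ ⟨hyU, hφ i' hi' hy⟩)) (not_le.mpr (hbig j hjT))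
      have hmem : ∀ i ∈ G, ∀ x ∈ K, ∃ j ∈ S i, φ i x ∈ U j := by
        intro i hi x hx
        obtain ⟨j, hj, hxj⟩ := mem_iUnion₂.mp (hcov (hφ i hi hx))
        exact ⟨j, Finset.mem_filter.mpr ⟨hj, x, hx, hxj⟩, hxj⟩
      obtain ⟨x₀, hx₀⟩ := hK
      have hcard : ∀ i ∈ G, (S i).card < N := by
        intro i hi
        obtain ⟨i', hi', hne⟩ := Finset.exists_mem_ne hG i
        obtain ⟨j, hj, -⟩ := hmem i' hi' x₀ hx₀
        rw [← hN]
        exact Finset.card_lt_card (Finset.ssubset_iff_of_subset (Finset.filter_subset _ _) |>.mpr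
          ⟨j, (Finset.mem_filter.mp hj).1, Finset.disjoint_left.mp (hdisj i' hi' i hi hne) hj⟩)
      have hpart : ∀ i ∈ G, r i ^ s * c ^ s ≤ ∑ j ∈ S i, d j ^ s := by
        intro i hi
        have hri := hr i hi
        have h := ih _ (hcard i hi) (S i) (fun j => φ i ⁻¹' U j) (fun j => d j / r i)
          (fun j hj => div_nonneg (hd j (Finset.mem_filter.mp hj).1) hri.le)
          (fun j hj x hx y hy => by
            rw [le_div_iff₀ hri, mul_comm]
            exact (hexp i hi x hx.2 y hy.2).trans (hU j (Finset.mem_filter.mp hj).1 _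
              ⟨hx.1, hφ i hi hx.2⟩ _ ⟨hy.1, hφ i hi hy.2⟩))
          (fun x hx => by
            obtain ⟨j, hj, hxj⟩ := hmem i hi x hx
            exact mem_iUnion₂.mpr ⟨j, hj, hxj⟩) rfl
        have hrs : 0 < r i ^ s := Real.rpow_pos_of_pos hri s
        have heq : ∑ j ∈ S i, (d j / r i) ^ s = (∑ j ∈ S i, d j ^ s) / r i ^ s := by
          rw [Finset.sum_div]
          exact Finset.sum_congr rfl fun j hj =>
            Real.div_rpow (hd j (Finset.mem_filter.mp hj).1) hri.le s
        rw [heq, le_div_iff₀ hrs] at h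
        linarith
      calc c ^ s ≤ (∑ i ∈ G, r i ^ s) * c ^ s :=
            le_mul_of_one_le_left (Real.rpow_nonneg hc.le s) hsum
        _ = ∑ i ∈ G, r i ^ s * c ^ s := Finset.sum_mul _ _ _
        _ ≤ ∑ i ∈ G, ∑ j ∈ S i, d j ^ s := Finset.sum_le_sum hpart
        _ = ∑ j ∈ G.biUnion S, d j ^ s := (Finset.sum_biUnion hdisj).symm
        _ ≤ ∑ j ∈ T, d j ^ s := by
            refine Finset.sum_le_sum_of_subset_of_nonneg ?_
              fun j hj _ => Real.rpow_nonneg (hd j hj) s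
            exact Finset.biUnion_subset.mpr fun i _ => Finset.filter_subset _ _

/-- A uniform positive lower bound for the `s`-dimensional sums of finite covers of `S`. -/
def HasCoverBound (S : Set ℝ) (s : ℝ) : Prop :=
  ∃ ε : ℝ, 0 < ε ∧ ∀ {κ : Type} (T : Finset κ) (U : κ → Set ℝ) (d : κ → ℝ),
    (∀ j ∈ T, 0 ≤ d j) → (∀ j ∈ T, ∀ x ∈ U j, ∀ y ∈ U j, |x - y| ≤ d j) →
    S ⊆ ⋃ j ∈ T, U j → ε ≤ ∑ j ∈ T, d j ^ s

theorem exists_pos_le_abs_sub {ι : Type*} (G : Finset ι) {A : ι → Set ℝ}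
    (hA : ∀ i ∈ G, IsCompact (A i)) (hdisj : ∀ i ∈ G, ∀ j ∈ G, i ≠ j → Disjoint (A i) (A j)) :
    ∃ c : ℝ, 0 < c ∧ ∀ i ∈ G, ∀ j ∈ G, i ≠ j → ∀ x ∈ A i, ∀ y ∈ A j, c ≤ |x - y| := by
  classical
  have h : ∀ q : ι × ι, ∃ c : ℝ, 0 < c ∧ (q.1 ∈ G → q.2 ∈ G → q.1 ≠ q.2 →
      ∀ x ∈ A q.1, ∀ y ∈ A q.2, c ≤ |x - y|) := by
    rintro ⟨i, j⟩
    by_cases hq : i ∈ G ∧ j ∈ G ∧ i ≠ j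
    · obtain ⟨hi, hj, hne⟩ := hq
      obtain ⟨c, hc, hlt⟩ := Metric.exists_pos_forall_lt_edist (hA i hi) (hA j hj).isClosed
        (hdisj i hi j hj hne)
      refine ⟨c, hc, fun _ _ _ x hx y hy => ?_⟩
      have := hlt x hx y hy
      rw [edist_nndist, ENNReal.coe_lt_coe] at this
      rw [← Real.dist_eq, ← coe_nndist]
      exact_mod_cast this.le
    · exact ⟨1, one_pos, fun hi hj hne => absurd ⟨hi, hj, hne⟩ hq⟩
  choose c hc hle using h
  rcases (G ×ˢ G).eq_empty_or_nonempty with hempty | hne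
  · refine ⟨1, one_pos, fun i hi j hj => ?_⟩
    have : (i, j) ∈ G ×ˢ G := Finset.mem_product.mpr ⟨hi, hj⟩
    simp [hempty] at this
  · obtain ⟨q, -, hq⟩ := Finset.exists_min_image (G ×ˢ G) c hne
    exact ⟨c q, hc q, fun i hi j hj hij x hx y hy =>
      (hq (i, j) (Finset.mem_product.mpr ⟨hi, hj⟩)).trans (hle (i, j) hi hj hij x hx y hy)⟩

theorem hasCoverBound_of_one_lt_sum_loops {m : ℕ} (F : CPLIFS m)
    (hinj : ∀ k, Function.Injective (F.f k)) {a b : ℝ} (hab : a < b)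
    (hmaps : ∀ k, MapsTo (F.f k) (Icc a b) (Icc a b)) (hiosc : IOSC F.f a b)
    {Λ : Set ℝ} (hne : Λ.Nonempty) (hΛI : Λ ⊆ Icc a b) (hΛ : ∀ k, MapsTo (F.f k) Λ Λ)
    {s : ℝ} (hs : 0 < s) {v : List (Fin m)} {n : ℕ}
    (hsum : 1 < ∑ g ∈ loops F.f a b v n, lipOn (fw F.f g) (fw F.f v '' Icc a b) ^ s) :
    HasCoverBound Λ s := by
  classical
  obtain ⟨R, hR, hR1, hlip⟩ := F.exists_contraction
  set J := fw F.f v '' Icc a b with hJ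
  set G := loops F.f a b v n with hG
  have hJI : J ⊆ Icc a b := (fw_mapsTo hmaps v).image_subset
  have hmemG : ∀ g ∈ G, g.length = n ∧ v <+: g ++ v ∧ ∀ x ∈ J, ∀ y ∈ J,
      |fw F.f g x - fw F.f g y| = lipOn (fw F.f g) J * |x - y| := fun g hg =>
    ⟨mem_words.mp (Finset.mem_filter.mp hg).1, (Finset.mem_filter.mp hg).2⟩
  obtain ⟨c, hc, hsep⟩ := exists_pos_le_abs_sub G (A := fun g => fw F.f g '' Icc a b)
    (fun g _ => isCompact_Icc.image (fw_continuous F.continuous g))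
    (fun g hg g' hg' hgg' => disjoint_left.mpr fun x hx hx' => hgg'
      (eq_of_mem_cylinder hinj hmaps hiosc ((hmemG g hg).1.trans (hmemG g' hg').1.symm) hx hx'))
  have hcard : 1 < G.card := by
    have hle : ∑ g ∈ G, lipOn (fw F.f g) J ^ s ≤ ∑ g ∈ G, (1 : ℝ) :=
      Finset.sum_le_sum fun g _ => Real.rpow_le_one (lipOn_nonneg _ _)
        ((lipOn_fw_le_pow hR.le hlip g _).trans (pow_le_one₀ hR.le hR1.le)) hs.le
    rw [Finset.sum_const, nsmul_eq_mul, mul_one] at hle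
    exact_mod_cast hsum.trans_le hle
  obtain ⟨x₀, hx₀⟩ := hne
  have hpos : ∀ g ∈ G, 0 < lipOn (fw F.f g) J := by
    intro g hg
    refine (lipOn_nonneg _ _).lt_of_ne' fun h0 => ?_
    have := (hmemG g hg).2.2 _ (mem_image_of_mem _ (left_mem_Icc.mpr hab.le))
      _ (mem_image_of_mem _ (right_mem_Icc.mpr hab.le))
    rw [h0, zero_mul, abs_eq_zero, sub_eq_zero] at this
    exact hab.ne (fw_injective hinj v (fw_injective hinj g this))
  have hmapsG : ∀ g ∈ G, MapsTo (fw F.f g) (Λ ∩ J) (Λ ∩ J) := by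
    rintro g hg _ ⟨hxΛ, x, hx, rfl⟩
    refine ⟨fw_mapsTo hΛ g hxΛ, ?_⟩
    obtain ⟨t, ht⟩ := (hmemG g hg).2.1
    have : fw F.f g (fw F.f v x) = fw F.f v (fw F.f t x) := by
      rw [← Function.comp_apply (f := fw F.f g), ← fw_append, ← ht, fw_append,
        Function.comp_apply]
    rw [this]
    exact mem_image_of_mem _ (fw_mapsTo hmaps t hx)
  refine ⟨c ^ s, Real.rpow_pos_of_pos hc s, fun T U d hd hU hcov => ?_⟩
  exact le_sum_rpow_of_cover (φ := fun g => fw F.f g) (r := fun g => lipOn (fw F.f g) J)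
    (K := Λ ∩ J) hs hc
    ⟨fw F.f v x₀, fw_mapsTo hΛ v hx₀, mem_image_of_mem _ (hΛI hx₀)⟩ hcard hpos hmapsG
    (fun g hg x hx y hy => ((hmemG g hg).2.2 x hx.2 y hy.2).ge)
    (fun g hg g' hg' hgg' x hx y hy => hsep g hg g' hg' hgg' _
      (mem_image_of_mem _ (hJI hx.2)) _ (mem_image_of_mem _ (hJI hy.2)))
    hsum.le T U d hd (fun j hj x hx y hy => hU j hj x hx.1 y hy.1)
    (inter_subset_left.trans hcov)

/-! ### From cover bounds to dimension bounds -/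

theorem le_dimH_of_hasCoverBound {S : Set ℝ} (hS : IsCompact S) {s : ℝ} (hs : 0 < s)
    (h : HasCoverBound S s) : ENNReal.ofReal s ≤ dimH S := by
  obtain ⟨ε, hε, hbound⟩ := h
  by_contra hlt
  have hzero : Measure.hausdorffMeasure s S = 0 := by
    have := hausdorffMeasure_of_dimH_lt (d := s.toNNReal) (not_le.mp hlt)
    rwa [Real.coe_toNNReal s hs.le] at this
  rw [Measure.hausdorffMeasure_apply] at hzero
  have hzero₁ := (le_iSup₂ (f := fun (r : ENNReal) (_ : 0 < r) =>
    ⨅ (t : ℕ → Set ℝ) (_ : S ⊆ ⋃ n, t n) (_ : ∀ n, Metric.ediam (t n) ≤ r),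
      ∑' n, ⨆ _ : (t n).Nonempty, Metric.ediam (t n) ^ s) 1 one_pos).trans hzero.le
  have hpos : (0 : ENNReal) < ENNReal.ofReal (ε / 2) := ENNReal.ofReal_pos.mpr (half_pos hε)
  have hlt₁ := hzero₁.trans_lt hpos
  simp only [iInf_lt_iff] at hlt₁
  obtain ⟨t, hcov, hdiam, hsum⟩ := hlt₁
  have htop : ∀ n, Metric.ediam (t n) ≠ ⊤ := fun n =>
    ((hdiam n).trans_lt ENNReal.one_lt_top).ne
  have hδ : ∀ n, ∃ δ : ℝ, 0 < δ ∧
      (Metric.diam (t n) + 2 * δ) ^ s ≤ Metric.diam (t n) ^ s + ε / 2 / 2 / 2 ^ n := by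
    intro n
    have hcont : Tendsto (fun δ : ℝ => (Metric.diam (t n) + 2 * δ) ^ s) (𝓝[>] 0)
        (𝓝 (Metric.diam (t n) ^ s)) := by
      have : Continuous fun δ : ℝ => (Metric.diam (t n) + 2 * δ) ^ s :=
        (by fun_prop : Continuous fun δ : ℝ => Metric.diam (t n) + 2 * δ).rpow_const
          fun _ => Or.inr hs.le
      simpa using (this.tendsto 0).mono_left nhdsWithin_le_nhds
    have hev := hcont.eventually_lt_const
      (show Metric.diam (t n) ^ s < Metric.diam (t n) ^ s + ε / 2 / 2 / 2 ^ n by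
        have : 0 < ε / 2 / 2 / 2 ^ n := by positivity
        linarith)
    obtain ⟨δ, hlt, hδ⟩ := (hev.and self_mem_nhdsWithin).exists
    exact ⟨δ, hδ, hlt.le⟩
  choose δ hδ0 hδ using hδ
  obtain ⟨T, hT⟩ := hS.elim_finite_subcover (fun n => Metric.thickening (δ n) (t n))
    (fun n => Metric.isOpen_thickening)
    (hcov.trans (iUnion_mono fun n => Metric.self_subset_thickening (hδ0 n) _))
  have hle := hbound T (fun n => Metric.thickening (δ n) (t n))
    (fun n => Metric.diam (t n) + 2 * δ n)
    (fun n _ => by have := hδ0 n; positivity)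
    (fun n _ x hx y hy => by
      obtain ⟨x', hx', hxx'⟩ := Metric.mem_thickening_iff.mp hx
      obtain ⟨y', hy', hyy'⟩ := Metric.mem_thickening_iff.mp hy
      have h₁ := Metric.dist_le_diam_of_mem' (htop n) hx' hy'
      have h₂ := dist_triangle4_right x y x' y'
      rw [← Real.dist_eq]
      linarith) hT
  have hA : ∑ n ∈ T, Metric.diam (t n) ^ s < ε / 2 := by
    rw [← ENNReal.ofReal_lt_ofReal_iff (half_pos hε), ENNReal.ofReal_sum_of_nonneg
      fun n _ => Real.rpow_nonneg Metric.diam_nonneg s]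
    refine lt_of_le_of_lt (le_trans (Finset.sum_le_sum fun n _ => ?_)
      (ENNReal.sum_le_tsum T)) hsum
    rw [← ENNReal.ofReal_rpow_of_nonneg Metric.diam_nonneg hs.le, Metric.diam,
      ENNReal.ofReal_toReal (htop n)]
    rcases (t n).eq_empty_or_nonempty with hn | hn
    · simp [hn, hs]
    · exact le_iSup (fun _ : (t n).Nonempty => Metric.ediam (t n) ^ s) hn
  have hB : ∑ n ∈ T, ε / 2 / 2 / 2 ^ n ≤ ε / 2 :=
    sum_le_hasSum T (fun n _ => by positivity) (hasSum_geometric_two' (ε / 2))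
  have hC := Finset.sum_le_sum fun n (_ : n ∈ T) => hδ n
  rw [Finset.sum_add_distrib] at hC
  linarith

theorem exists_cover_card_eq_coverNumber {S : Set ℝ} (hS : IsCompact S) {δ : ℝ} (hδ : 0 < δ) :
    ∃ t : Finset ℝ, t.card = coverNumber S δ ∧ S ⊆ ⋃ c ∈ t, Metric.closedBall c δ := by
  have hne : {n : ℕ | ∃ t : Finset ℝ, t.card = n ∧
      S ⊆ ⋃ c ∈ t, Metric.closedBall c δ}.Nonempty := by
    obtain ⟨t, -, hfin, ht⟩ := hS.finite_cover_balls hδ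
    refine ⟨_, hfin.toFinset, rfl, ht.trans ?_⟩
    simp only [Finite.mem_toFinset]
    exact iUnion₂_mono fun c _ => Metric.ball_subset_closedBall
  exact Nat.sInf_mem hne

theorem coverNumber_pos {S : Set ℝ} (hS : IsCompact S) (hne : S.Nonempty) {δ : ℝ} (hδ : 0 < δ) :
    0 < coverNumber S δ := by
  obtain ⟨t, hcard, ht⟩ := exists_cover_card_eq_coverNumber hS hδ
  rw [← hcard, Finset.card_pos]
  obtain ⟨x, hx⟩ := hne
  obtain ⟨c, hc, -⟩ := mem_iUnion₂.mp (ht hx)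
  exact ⟨c, hc⟩

theorem HasCoverBound.exists_le_coverNumber_mul {S : Set ℝ} (hS : IsCompact S) {s : ℝ}
    (h : HasCoverBound S s) : ∃ ε : ℝ, 0 < ε ∧ ∀ δ : ℝ, 0 < δ → ε ≤ coverNumber S δ * δ ^ s := by
  obtain ⟨ε, hε, hbound⟩ := h
  have h2 : (0 : ℝ) < 2 ^ s := by positivity
  refine ⟨ε / 2 ^ s, by positivity, fun δ hδ => ?_⟩
  obtain ⟨t, hcard, ht⟩ := exists_cover_card_eq_coverNumber hS hδ
  have hle := hbound t (fun c => Metric.closedBall c δ) (fun _ => 2 * δ)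
    (fun _ _ => by positivity)
    (fun c _ x hx y hy => by
      rw [← Real.dist_eq]
      have := dist_triangle_right x y c
      rw [Metric.mem_closedBall] at hx hy
      linarith) ht
  rw [Finset.sum_const, nsmul_eq_mul, hcard, Real.mul_rpow zero_le_two hδ.le] at hle
  rw [div_le_iff₀ h2]
  linarith

theorem tendsto_neg_log_nhdsGT_zero : Tendsto (fun δ : ℝ => -Real.log δ) (𝓝[>] 0) atTop :=
  tendsto_neg_atBot_atTop.comp Real.tendsto_log_nhdsGT_zero

theorem eventually_lt_log_coverNumber_div {S : Set ℝ} {ε s t : ℝ} (hε : 0 < ε) (hts : t < s)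
    (h : ∀ δ : ℝ, 0 < δ → ε ≤ coverNumber S δ * δ ^ s) :
    ∀ᶠ δ in 𝓝[>] (0 : ℝ), t < Real.log (coverNumber S δ) / -Real.log δ := by
  filter_upwards [self_mem_nhdsWithin, tendsto_neg_log_nhdsGT_zero.eventually_gt_atTop 0,
    tendsto_neg_log_nhdsGT_zero.eventually_gt_atTop (-Real.log ε / (s - t))] with δ hδ hlog hbig
  have hδ0 : (0 : ℝ) < δ := hδ
  have hδs : 0 < δ ^ s := Real.rpow_pos_of_pos hδ0 s
  have hN : (0 : ℝ) < coverNumber S δ := pos_of_mul_pos_left (hε.trans_le (h δ hδ0)) hδs.le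
  have hle := Real.log_le_log hε (h δ hδ0)
  rw [Real.log_mul hN.ne' hδs.ne', Real.log_rpow hδ0] at hle
  rw [div_lt_iff₀ (sub_pos.mpr hts)] at hbig
  rw [lt_div_iff₀ hlog]
  nlinarith

theorem eventually_log_coverNumber_div_lt {S : Set ℝ} (hS : IsCompact S) (hne : S.Nonempty)
    {C s t : ℝ} (hst : s < t)
    (h : ∀ᶠ δ in 𝓝[>] (0 : ℝ), coverNumber S δ * δ ^ s ≤ C) :
    ∀ᶠ δ in 𝓝[>] (0 : ℝ), Real.log (coverNumber S δ) / -Real.log δ < t := by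
  filter_upwards [self_mem_nhdsWithin, h, tendsto_neg_log_nhdsGT_zero.eventually_gt_atTop 0,
    tendsto_neg_log_nhdsGT_zero.eventually_gt_atTop (Real.log C / (t - s))] with δ hδ hC hlog hbig
  have hδ0 : (0 : ℝ) < δ := hδ
  have hδs : 0 < δ ^ s := Real.rpow_pos_of_pos hδ0 s
  have hN : (0 : ℝ) < coverNumber S δ := by exact_mod_cast coverNumber_pos hS hne hδ0
  have hle := Real.log_le_log (mul_pos hN hδs) hC
  rw [Real.log_mul hN.ne' hδs.ne', Real.log_rpow hδ0] at hle
  rw [div_lt_iff₀ (sub_pos.mpr hst)] at hbig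
  rw [div_lt_iff₀ hlog]
  nlinarith

/-! ### The attractor -/

section Attractor

variable {m : ℕ} {F : CPLIFS m} {a b : ℝ} {Λ : Set ℝ}

theorem IsAttractor.mapsTo (hΛ : IsAttractor F Λ) (k : Fin m) : MapsTo (F.f k) Λ Λ := by
  intro x hx
  rw [hΛ.2.2]
  exact mem_iUnion.mpr ⟨k, mem_image_of_mem _ hx⟩

theorem IsAttractor.subset_Icc (hΛ : IsAttractor F Λ) (hab : a ≤ b)
    (hmaps : ∀ k, MapsTo (F.f k) (Icc a b) (Icc a b)) : Λ ⊆ Icc a b := by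
  obtain ⟨R, hR, hR1, hlip⟩ := F.exists_contraction
  have hne : (Icc a b).Nonempty := nonempty_Icc.mpr hab
  obtain ⟨x, hx, hmax⟩ := hΛ.2.1.exists_isMaxOn hΛ.1
    (Metric.continuous_infDist_pt (Icc a b)).continuousOn
  have hx' := hx
  rw [hΛ.2.2] at hx'
  obtain ⟨k, y, hy, rfl⟩ := mem_iUnion.mp hx'
  obtain ⟨z, hz, hdist⟩ := isCompact_Icc.exists_infDist_eq_dist hne y
  have h₁ : Metric.infDist (F.f k y) (Icc a b) ≤ R * Metric.infDist y (Icc a b) := by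
    refine (Metric.infDist_le_dist_of_mem (hmaps k hz)).trans ?_
    rw [hdist, Real.dist_eq, Real.dist_eq]
    exact hlip k y z
  have h₂ : Metric.infDist y (Icc a b) ≤ Metric.infDist (F.f k y) (Icc a b) := hmax hy
  have h₀ : 0 ≤ Metric.infDist y (Icc a b) := Metric.infDist_nonneg
  have hzero : Metric.infDist (F.f k y) (Icc a b) ≤ 0 := by nlinarith
  intro w hw
  rw [isClosed_Icc.mem_iff_infDist_zero hne]
  exact le_antisymm ((hmax hw : _ ≤ _).trans hzero) Metric.infDist_nonneg

theorem IsAttractor.exists_word (hΛ : IsAttractor F Λ) (n : ℕ) {x : ℝ} (hx : x ∈ Λ) :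
    ∃ w ∈ words m n, x ∈ fw F.f w '' Λ := by
  induction n generalizing x with
  | zero => exact ⟨[], mem_words.mpr rfl, x, hx, rfl⟩
  | succ n ih =>
    rw [hΛ.2.2] at hx
    obtain ⟨k, y, hy, rfl⟩ := mem_iUnion.mp hx
    obtain ⟨w, hw, z, hz, rfl⟩ := ih hy
    exact ⟨k :: w, mem_words.mpr (by rw [List.length_cons, mem_words.mp hw]), z, hz, rfl⟩

theorem cylLen_le_pow {R : ℝ} (hab : a ≤ b) (hR : 0 ≤ R)
    (hlip : ∀ k x y, |F.f k x - F.f k y| ≤ R * |x - y|) (w : List (Fin m)) :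
    cylLen F.f a b w ≤ R ^ w.length * (b - a) :=
  cylLen_le F.continuous hab w (pow_nonneg hR _) fun x _ y _ => fw_contraction hR hlip w x y

theorem pow_le_cylLen {r : ℝ} (hab : a ≤ b) (hr : 0 ≤ r)
    (hexp : ∀ k x y, r * |x - y| ≤ |F.f k x - F.f k y|) (w : List (Fin m)) :
    r ^ w.length * (b - a) ≤ cylLen F.f a b w := by
  have h := abs_sub_le_cylLen F.continuous hab w
    (mem_image_of_mem _ (right_mem_Icc.mpr hab)) (mem_image_of_mem _ (left_mem_Icc.mpr hab))
  refine le_trans ?_ ((fw_expansion hr hexp w b a).trans h)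
  rw [abs_of_nonneg (sub_nonneg.mpr hab)]

theorem cylSum_nonneg (f : Fin m → ℝ → ℝ) (a b : ℝ) (n : ℕ) (s : ℝ) : 0 ≤ cylSum f a b n s :=
  Finset.sum_nonneg fun _ _ => Real.rpow_nonneg (cylLen_nonneg _ _ _ _) _

theorem IsAttractor.coverNumber_mul_le (hΛ : IsAttractor F Λ) (hab : a < b)
    (hmaps : ∀ k, MapsTo (F.f k) (Icc a b) (Icc a b)) {s : ℝ} (hs : 0 ≤ s)
    (hsum : Summable fun n => cylSum F.f a b n s) {δ : ℝ} (hδ : 0 < δ) (hδ' : δ < b - a) :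
    coverNumber Λ δ * δ ^ s ≤ m * ∑' n, cylSum F.f a b n s := by
  classical
  obtain ⟨R, hR, hR1, hlip⟩ := F.exists_contraction
  have hΛI := hΛ.subset_Icc hab.le hmaps
  obtain ⟨N, hN⟩ : ∃ N : ℕ, R ^ N * (b - a) ≤ δ := by
    obtain ⟨N, hN⟩ := exists_pow_lt_of_lt_one (div_pos hδ (sub_pos.mpr hab)) hR1
    exact ⟨N, ((lt_div_iff₀ (sub_pos.mpr hab)).mp hN).le⟩
  set Q : Finset (List (Fin m)) :=
    ((Finset.range N).biUnion (words m)).filter fun u => δ < cylLen F.f a b u with hQ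
  set t : Finset ℝ := (Q ×ˢ (Finset.univ : Finset (Fin m))).image
    fun q => fw F.f (q.1 ++ [q.2]) a with ht
  have hcov : Λ ⊆ ⋃ c ∈ t, Metric.closedBall c δ := by
    intro x hx
    obtain ⟨w, hw, y, hy, rfl⟩ := hΛ.exists_word N hx
    have hlen := mem_words.mp hw
    have hex : ∃ i, cylLen F.f a b (w.take i) ≤ δ := by
      refine ⟨N, (cylLen_le_pow hab.le hR.le hlip _).trans ?_⟩
      rwa [List.length_take, hlen, min_self]
    obtain ⟨i, hi, hmin⟩ : ∃ i, cylLen F.f a b (w.take i) ≤ δ ∧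
        ∀ j < i, ¬ cylLen F.f a b (w.take j) ≤ δ :=
      ⟨Nat.find hex, Nat.find_spec hex, fun j => Nat.find_min hex⟩
    have hiN : i ≤ N := by
      by_contra hlt
      refine hmin N (not_le.mp hlt) ((cylLen_le_pow hab.le hR.le hlip _).trans ?_)
      rwa [List.length_take, hlen, min_self]
    cases i with
    | zero =>
      have : cylLen F.f a b [] = b - a := by
        rw [cylLen, fw_nil, image_id, Real.volume_Icc,
          ENNReal.toReal_ofReal (sub_nonneg.mpr hab.le)]
      rw [List.take_zero, this] at hi
      linarith
    | succ j =>
      have htake : w.take (j + 1) = w.take j ++ [w[j]'(by omega)] :=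
        List.take_succ_eq_append_getElem (by omega)
      refine mem_iUnion₂.mpr ⟨fw F.f (w.take (j + 1)) a, ?_, ?_⟩
      · rw [htake]
        refine Finset.mem_image.mpr ⟨(w.take j, w[j]'(by omega)), Finset.mem_product.mpr
          ⟨Finset.mem_filter.mpr ⟨Finset.mem_biUnion.mpr ⟨j, Finset.mem_range.mpr (by omega),
            mem_words.mpr ?_⟩, not_le.mp (hmin j (Nat.lt_succ_self j))⟩, Finset.mem_univ _⟩, rfl⟩
        rw [List.length_take]
        omega
      · rw [Metric.mem_closedBall, Real.dist_eq]
        refine (abs_sub_le_cylLen F.continuous hab.le _ ?_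
          (mem_image_of_mem _ (left_mem_Icc.mpr hab.le))).trans hi
        conv => arg 2; rw [← List.take_append_drop (j + 1) w, fw_append]
        exact mem_image_of_mem _ (fw_mapsTo hmaps _ (hΛI hy))
  have hcard : (coverNumber Λ δ : ℝ) ≤ Q.card * m := by
    have h₁ : coverNumber Λ δ ≤ t.card := Nat.sInf_le ⟨t, rfl, hcov⟩
    have h₂ : t.card ≤ Q.card * m := by
      refine Finset.card_image_le.trans_eq ?_
      rw [Finset.card_product, Finset.card_univ, Fintype.card_fin]
    exact_mod_cast h₁.trans h₂
  have hQsum : Q.card * δ ^ s ≤ ∑' n, cylSum F.f a b n s := by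
    calc Q.card * δ ^ s = ∑ _u ∈ Q, δ ^ s := by rw [Finset.sum_const, nsmul_eq_mul]
      _ ≤ ∑ u ∈ Q, cylLen F.f a b u ^ s := Finset.sum_le_sum fun u hu =>
          Real.rpow_le_rpow hδ.le (Finset.mem_filter.mp hu).2.le hs
      _ ≤ ∑ u ∈ (Finset.range N).biUnion (words m), cylLen F.f a b u ^ s :=
          Finset.sum_le_sum_of_subset_of_nonneg (Finset.filter_subset _ _)
            fun u _ _ => Real.rpow_nonneg (cylLen_nonneg _ _ _ _) s
      _ = ∑ n ∈ Finset.range N, cylSum F.f a b n s := by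
          rw [Finset.sum_biUnion]
          · exact Finset.sum_congr rfl fun n _ => (cylSum_eq_sum_words _ _ _ _ _).symm
          · intro i _ j _ hij
            refine Finset.disjoint_left.mpr fun u hu hu' => hij ?_
            rw [← mem_words.mp hu, ← mem_words.mp hu']
      _ ≤ _ := hsum.sum_le_tsum _ fun n _ => cylSum_nonneg _ _ _ _ _
  calc coverNumber Λ δ * δ ^ s ≤ Q.card * m * δ ^ s :=
        mul_le_mul_of_nonneg_right hcard (Real.rpow_nonneg hδ.le s)
    _ = m * (Q.card * δ ^ s) := by ring
    _ ≤ _ := mul_le_mul_of_nonneg_left hQsum (Nat.cast_nonneg m)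

theorem IsAttractor.dimH_le (hΛ : IsAttractor F Λ) (hab : a ≤ b)
    (hmaps : ∀ k, MapsTo (F.f k) (Icc a b) (Icc a b)) {s : ℝ} (hs : 0 ≤ s)
    (hsum : Summable fun n => cylSum F.f a b n s) : dimH Λ ≤ ENNReal.ofReal s := by
  obtain ⟨R, hR, hR1, hlip⟩ := F.exists_contraction
  have hΛI := hΛ.subset_Icc hab hmaps
  have hdiam : ∀ w : List (Fin m), Metric.ediam (fw F.f w '' Icc a b) ≤
      ENNReal.ofReal (cylLen F.f a b w) := fun w =>
    Metric.ediam_le fun x hx y hy => by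
      rw [edist_dist, Real.dist_eq]
      exact ENNReal.ofReal_le_ofReal (abs_sub_le_cylLen F.continuous hab w hx hy)
  have hzero : Measure.hausdorffMeasure s Λ ≤ 0 := by
    refine (Measure.hausdorffMeasure_le_liminf_sum (l := atTop) s Λ
      (fun n : ℕ => ENNReal.ofReal (R ^ n * (b - a))) ?_
      (fun n (w : Fin n → Fin m) => fw F.f (List.ofFn w) '' Icc a b) ?_ ?_).trans ?_
    · have : Tendsto (fun n : ℕ => R ^ n * (b - a)) atTop (𝓝 (0 * (b - a))) :=
        (tendsto_pow_atTop_nhds_zero_of_lt_one hR.le hR1).mul_const _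
      simpa using ENNReal.tendsto_ofReal this
    · refine Eventually.of_forall fun n w => (hdiam _).trans (ENNReal.ofReal_le_ofReal ?_)
      simpa using cylLen_le_pow hab hR.le hlip (List.ofFn w)
    · refine Eventually.of_forall fun n x hx => ?_
      obtain ⟨w, hw, hxw⟩ := hΛ.exists_word n hx
      obtain ⟨g, -, rfl⟩ := Finset.mem_map.mp hw
      exact mem_iUnion.mpr ⟨g, image_mono hΛI hxw⟩
    · have hlim : Tendsto (fun n => ENNReal.ofReal (cylSum F.f a b n s)) atTop (𝓝 0) := by
        simpa using ENNReal.tendsto_ofReal hsum.tendsto_atTop_zero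
      rw [← hlim.liminf_eq]
      refine liminf_le_liminf (Eventually.of_forall fun n => ?_)
      rw [cylSum, ENNReal.ofReal_sum_of_nonneg
        fun w _ => Real.rpow_nonneg (cylLen_nonneg _ _ _ _) s]
      refine Finset.sum_le_sum fun w _ => ?_
      rw [← ENNReal.ofReal_rpow_of_nonneg (cylLen_nonneg _ _ _ _) hs]
      exact ENNReal.rpow_le_rpow (hdiam _) hs
  have := dimH_le_of_hausdorffMeasure_ne_top (s := Λ) (d := s.toNNReal) (by
    rw [Real.coe_toNNReal s hs]
    exact (hzero.trans_lt ENNReal.zero_lt_top).ne)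
  exact this

/-! ### The natural pressure -/

theorem cylSum_add_le {R : ℝ} (hab : a ≤ b) (hR : 0 ≤ R)
    (hlip : ∀ k x y, |F.f k x - F.f k y| ≤ R * |x - y|) (n : ℕ) {t d : ℝ} (ht : 0 ≤ t)
    (hd : 0 ≤ d) :
    cylSum F.f a b n (t + d) ≤ cylSum F.f a b n t * ((R ^ d) ^ n * (b - a) ^ d) := by
  rw [cylSum_eq_sum_words, cylSum_eq_sum_words, Finset.sum_mul]
  refine Finset.sum_le_sum fun w hw => ?_
  rw [Real.rpow_add_of_nonneg (cylLen_nonneg _ _ _ _) ht hd]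
  refine mul_le_mul_of_nonneg_left ?_ (Real.rpow_nonneg (cylLen_nonneg _ _ _ _) _)
  refine (Real.rpow_le_rpow (cylLen_nonneg _ _ _ _)
    (cylLen_le_pow hab hR hlip w) hd).trans_eq ?_
  rw [mem_words.mp hw, Real.mul_rpow (pow_nonneg hR _) (sub_nonneg.mpr hab),
    ← Real.rpow_natCast, ← Real.rpow_natCast, ← Real.rpow_mul hR, ← Real.rpow_mul hR, mul_comm d]

theorem rpow_le_cylSum {r : ℝ} (hab : a < b) (hr : 0 < r)
    (hexp : ∀ k x y, r * |x - y| ≤ |F.f k x - F.f k y|) (n : ℕ) {s : ℝ} (hs : 0 ≤ s) :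
    (r ^ n * (b - a)) ^ s ≤ cylSum F.f a b n s := by
  have hm := F.hm
  have hw : List.replicate n (⟨0, by omega⟩ : Fin m) ∈ words m n := mem_words.mpr (by simp)
  rw [cylSum_eq_sum_words]
  refine le_trans (Real.rpow_le_rpow (mul_nonneg (pow_nonneg hr.le _) (sub_nonneg.mpr hab.le))
    ?_ hs) (Finset.single_le_sum (f := fun w => cylLen F.f a b w ^ s)
      (fun w _ => Real.rpow_nonneg (cylLen_nonneg _ _ _ _) s) hw)
  simpa using pow_le_cylLen hab.le hr.le hexp (List.replicate n (⟨0, by omega⟩ : Fin m))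

theorem cylSum_pos (hinj : ∀ k, Function.Injective (F.f k)) (hab : a < b) (n : ℕ) {s : ℝ}
    (hs : 0 ≤ s) : 0 < cylSum F.f a b n s := by
  obtain ⟨r, hr, hexp⟩ := F.exists_expansion hinj
  have hba : 0 < b - a := sub_pos.mpr hab
  exact lt_of_lt_of_le (by positivity) (rpow_le_cylSum hab hr hexp n hs)

theorem isBoundedUnder_le_pressure (hinj : ∀ k, Function.Injective (F.f k)) (hab : a < b) {s : ℝ}
    (hs : 0 ≤ s) : IsBoundedUnder (· ≤ ·) atTop
      fun n : ℕ => (n : ℝ)⁻¹ * Real.log (cylSum F.f a b n s) := by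
  obtain ⟨R, hR, hR1, hlip⟩ := F.exists_contraction
  have hba : 0 < b - a := sub_pos.mpr hab
  have hm : (0 : ℝ) < m := by
    have := F.hm
    exact_mod_cast (by omega : 0 < m)
  refine isBoundedUnder_of_eventually_le (a := Real.log m + s * |Real.log (b - a)|) ?_
  filter_upwards [eventually_ge_atTop 1] with n hn
  have hn' : (1 : ℝ) ≤ n := by exact_mod_cast hn
  have hle : cylSum F.f a b n s ≤ (m : ℝ) ^ n * (b - a) ^ s := by
    have h0 := cylSum_add_le hab.le hR.le hlip n le_rfl hs
    have h1 : cylSum F.f a b n 0 = (m : ℝ) ^ n := by simp [cylSum]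
    rw [zero_add, h1] at h0
    refine h0.trans (mul_le_mul_of_nonneg_left ?_ (by positivity))
    exact mul_le_of_le_one_left (by positivity)
      (pow_le_one₀ (by positivity) (Real.rpow_le_one hR.le hR1.le hs))
  have hlog := Real.log_le_log (cylSum_pos hinj hab n hs) hle
  rw [Real.log_mul (by positivity) (by positivity), Real.log_pow, Real.log_rpow hba] at hlog
  rw [inv_mul_le_iff₀ (by linarith)]
  have h1 : s * Real.log (b - a) ≤ s * |Real.log (b - a)| :=
    mul_le_mul_of_nonneg_left (le_abs_self _) hs
  have h2 : 0 ≤ s * |Real.log (b - a)| := by positivity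
  nlinarith

theorem isBoundedUnder_ge_pressure (hinj : ∀ k, Function.Injective (F.f k)) (hab : a < b) {s : ℝ}
    (hs : 0 ≤ s) : IsBoundedUnder (· ≥ ·) atTop
      fun n : ℕ => (n : ℝ)⁻¹ * Real.log (cylSum F.f a b n s) := by
  obtain ⟨r, hr, hexp⟩ := F.exists_expansion hinj
  have hba : 0 < b - a := sub_pos.mpr hab
  refine isBoundedUnder_of_eventually_ge (a := s * Real.log r - s * |Real.log (b - a)|) ?_
  filter_upwards [eventually_ge_atTop 1] with n hn
  have hn' : (1 : ℝ) ≤ n := by exact_mod_cast hn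
  have hlog := Real.log_le_log (by positivity) (rpow_le_cylSum hab hr hexp n hs)
  rw [Real.log_rpow (by positivity), Real.log_mul (by positivity) hba.ne', Real.log_pow] at hlog
  rw [le_inv_mul_iff₀ (by linarith)]
  have h1 : s * -|Real.log (b - a)| ≤ s * Real.log (b - a) :=
    mul_le_mul_of_nonneg_left (neg_abs_le _) hs
  have h2 : 0 ≤ s * |Real.log (b - a)| := by positivity
  nlinarith

theorem IsNaturalDim.summable_cylSum {sF s : ℝ} (hsF : IsNaturalDim F.f a b sF)
    (hinj : ∀ k, Function.Injective (F.f k)) (hab : a < b) (hs : sF < s) :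
    Summable fun n => cylSum F.f a b n s := by
  obtain ⟨R, hR, hR1, hlip⟩ := F.exists_contraction
  obtain ⟨hsF0, hzero, -⟩ := hsF
  have hba : 0 < b - a := sub_pos.mpr hab
  set d := s - sF with hd
  have hd0 : 0 < d := sub_pos.mpr hs
  set η := d * -Real.log R / 2 with hη
  have hη0 : 0 < η := by
    have := Real.log_neg hR hR1
    have : 0 < -Real.log R := by linarith
    positivity
  have hRd : R ^ d = Real.exp (-2 * η) := by
    rw [Real.rpow_def_of_pos hR]
    congr 1
    rw [hη]
    ring
  have hev := eventually_lt_of_limsup_lt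
    (show limsup (fun n : ℕ => (n : ℝ)⁻¹ * Real.log (cylSum F.f a b n sF)) atTop < η from
      hzero.trans_lt hη0) (isBoundedUnder_le_pressure hinj hab hsF0)
  refine Summable.of_norm_bounded_eventually_nat (g := fun n => (b - a) ^ d * Real.exp (-η) ^ n)
    ((summable_geometric_of_lt_one (Real.exp_pos _).le
      (Real.exp_lt_one_iff.mpr (by linarith))).mul_left _) ?_
  filter_upwards [hev, eventually_ge_atTop 1] with n hn hn1
  have hn' : (0 : ℝ) < n := by exact_mod_cast hn1
  rw [inv_mul_lt_iff₀ hn'] at hn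
  have hZ := (Real.log_lt_iff_lt_exp (cylSum_pos hinj hab n hsF0)).mp hn
  have hle := cylSum_add_le hab.le hR.le hlip n hsF0 hd0.le
  rw [show sF + d = s by rw [hd]; ring] at hle
  rw [Real.norm_of_nonneg (cylSum_nonneg _ _ _ _ _)]
  refine hle.trans ((mul_le_mul_of_nonneg_right hZ.le (by positivity)).trans_eq ?_)
  rw [hRd, ← Real.exp_nat_mul, ← Real.exp_nat_mul, ← mul_assoc, ← Real.exp_add, mul_comm]
  congr 2
  ring

/-- Below the natural dimension the cylinder sums grow exponentially along a subsequence. -/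
theorem IsNaturalDim.exists_growth {sF s : ℝ} (hsF : IsNaturalDim F.f a b sF)
    (hinj : ∀ k, Function.Injective (F.f k)) (hab : a < b) (hs0 : 0 ≤ s) (hs : s < sF) :
    ∃ μ : ℝ, 1 < μ ∧ ∀ C : ℝ, ∃ n, C * μ ^ n < cylSum F.f a b n s := by
  obtain ⟨R, hR, hR1, hlip⟩ := F.exists_contraction
  obtain ⟨hsF0, hzero, -⟩ := hsF
  have hba : 0 < b - a := sub_pos.mpr hab
  set d := sF - s with hd
  have hd0 : 0 < d := sub_pos.mpr hs
  set η := d * -Real.log R / 3 with hη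
  have hη0 : 0 < η := by
    have := Real.log_neg hR hR1
    have : 0 < -Real.log R := by linarith
    positivity
  have hRd : R ^ d = Real.exp (-3 * η) := by
    rw [Real.rpow_def_of_pos hR]
    congr 1
    rw [hη]
    ring
  refine ⟨Real.exp η, Real.one_lt_exp_iff.mpr hη0, fun C => ?_⟩
  have hfreq := frequently_lt_of_lt_limsup
    (isBoundedUnder_ge_pressure hinj hab hsF0).isCoboundedUnder_le
    (show -η < limsup (fun n : ℕ => (n : ℝ)⁻¹ * Real.log (cylSum F.f a b n sF)) atTop from
      (neg_lt_zero.mpr hη0).trans_eq hzero.symm)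
  have hlim : Tendsto (fun n : ℕ => Real.exp η ^ n) atTop atTop :=
    tendsto_pow_atTop_atTop_of_one_lt (Real.one_lt_exp_iff.mpr hη0)
  obtain ⟨n, hn, hn1, hbig⟩ := (hfreq.and_eventually ((eventually_ge_atTop 1).and
    (hlim.eventually_ge_atTop (C * (b - a) ^ d)))).exists
  refine ⟨n, ?_⟩
  have hn' : (0 : ℝ) < n := by exact_mod_cast hn1
  rw [lt_inv_mul_iff₀ hn'] at hn
  have hZ := (Real.lt_log_iff_exp_lt (cylSum_pos hinj hab n hsF0)).mp hn
  have hle := cylSum_add_le hab.le hR.le hlip n hs0 hd0.le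
  rw [show s + d = sF by rw [hd]; ring] at hle
  have hlt := hZ.trans_le hle
  by_contra hnot
  push Not at hnot
  refine absurd hlt (not_lt.mpr ?_)
  have hpos : 0 ≤ (R ^ d) ^ n * (b - a) ^ d := by positivity
  calc cylSum F.f a b n s * ((R ^ d) ^ n * (b - a) ^ d)
      ≤ C * Real.exp η ^ n * ((R ^ d) ^ n * (b - a) ^ d) := mul_le_mul_of_nonneg_right hnot hpos
    _ = C * (b - a) ^ d * (Real.exp η ^ n * (R ^ d) ^ n) := by ring
    _ ≤ Real.exp η ^ n * (Real.exp η ^ n * (R ^ d) ^ n) :=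
        mul_le_mul_of_nonneg_right hbig (by positivity)
    _ = Real.exp (n * -η) := by
        rw [hRd, ← Real.exp_nat_mul, ← Real.exp_nat_mul, ← Real.exp_add, ← Real.exp_add]
        congr 1
        ring

theorem IsNaturalDim.hasCoverBound {sF s : ℝ} (hsF : IsNaturalDim F.f a b sF)
    (hinj : ∀ k, Function.Injective (F.f k)) (hab : a < b)
    (hmaps : ∀ k, MapsTo (F.f k) (Icc a b) (Icc a b)) (hiosc : IOSC F.f a b)
    (hΛ : IsAttractor F Λ) (hs0 : 0 < s) (hs : s < sF) : HasCoverBound Λ s := by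
  obtain ⟨R, hR, hR1, hlip⟩ := F.exists_contraction
  have hba : 0 < b - a := sub_pos.mpr hab
  have hRs0 : 0 < R ^ s := Real.rpow_pos_of_pos hR s
  have hRs1 : R ^ s < 1 := Real.rpow_lt_one hR.le hR1 hs0
  obtain ⟨p, hp, hpR⟩ : ∃ p : ℕ, 1 ≤ p ∧
      Fintype.card ((k : Fin m) × Fin (F.l k)) * ((R ^ s) ^ p / (1 - R ^ s)) ≤ 1 / 2 := by
    have hlim : Tendsto (fun p : ℕ => (Fintype.card ((k : Fin m) × Fin (F.l k)) : ℝ) *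
        ((R ^ s) ^ p / (1 - R ^ s))) atTop (𝓝 0) := by
      simpa using ((tendsto_pow_atTop_nhds_zero_of_lt_one hRs0.le hRs1).div_const
        (1 - R ^ s)).const_mul (Fintype.card ((k : Fin m) × Fin (F.l k)) : ℝ)
    exact ((eventually_ge_atTop 1).and (hlim.eventually_le_const one_half_pos)).exists
  by_contra hno
  have hloops : ∀ v ∈ words m p, ∀ n,
      ∑ g ∈ loops F.f a b v n, lipOn (fw F.f g) (fw F.f v '' Icc a b) ^ s ≤ 1 := by
    intro v _ n
    by_contra hlt
    exact hno (hasCoverBound_of_one_lt_sum_loops F hinj hab hmaps hiosc hΛ.1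
      (hΛ.subset_Icc hab.le hmaps) hΛ.mapsTo hs0 (not_le.mp hlt))
  obtain ⟨μ, hμ, hgrow⟩ := hsF.exists_growth hinj hab hs0.le hs
  obtain ⟨C, hC, hbound⟩ := exists_avoidSum_le hab.le hR.le hR1 hlip hinj hmaps hiosc hs0 hp hpR
    hloops hμ ∅
  obtain ⟨n, hn⟩ := hgrow (C * (b - a) ^ s)
  refine absurd hn (not_lt.mpr ?_)
  have hall : avoiding (∅ : Finset (List (Fin m))) n = words m n := by
    classical
    exact Finset.filter_true_of_mem fun w _ e he => absurd he (Finset.notMem_empty e)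
  calc cylSum F.f a b n s ≤ ∑ w ∈ words m n, lipOn (fw F.f w) (Icc a b) ^ s * (b - a) ^ s := by
        rw [cylSum_eq_sum_words]
        refine Finset.sum_le_sum fun w _ => ?_
        rw [← Real.mul_rpow (lipOn_nonneg _ _) hba.le]
        refine Real.rpow_le_rpow (cylLen_nonneg _ _ _ _) ?_ hs0.le
        exact cylLen_le F.continuous hab.le w (lipOn_nonneg _ _) fun x hx y hy =>
          abs_sub_le_lipOn (pow_nonneg hR.le w.length)
            (fun x _ y _ => fw_contraction hR.le hlip w x y) hx hy
    _ = avoidSum F.f a b s ∅ n * (b - a) ^ s := by rw [avoidSum, hall, Finset.sum_mul]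
    _ ≤ C * μ ^ n * (b - a) ^ s := mul_le_mul_of_nonneg_right (hbound n) (by positivity)
    _ = C * (b - a) ^ s * μ ^ n := by ring

theorem lt_of_IOSC (F : CPLIFS m) (hab : a ≤ b)
    (hmaps : ∀ k, MapsTo (F.f k) (Icc a b) (Icc a b)) (hiosc : IOSC F.f a b) : a < b := by
  refine hab.lt_of_ne fun heq => ?_
  subst heq
  have hm := F.hm
  have ha : a ∈ Icc a a := left_mem_Icc.mpr le_rfl
  have hfix : ∀ k, F.f k a = a := fun k => by simpa using hmaps k ha
  exact disjoint_left.mp (hiosc ⟨0, by omega⟩ ⟨1, by omega⟩ (by simp))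
    ⟨a, ha, hfix _⟩ ⟨a, ha, hfix _⟩

end Attractor

/-- For an injective CPLIFS satisfying the IOSC, the box dimension of the
attractor exists (lower = upper box dimension), and the Hausdorff and box dimensions both
equal the natural dimension `s_F`. -/
theorem statement11 {m : ℕ} (F : CPLIFS m)
    (hinj : ∀ k, Function.Injective (F.f k))
    (a b : ℝ) (hI : SmallestInvariantInterval F.f a b)
    (hiosc : IOSC F.f a b)
    (Λ : Set ℝ) (hΛ : IsAttractor F Λ)
    (sF : ℝ) (hsF : IsNaturalDim F.f a b sF) :
    lowerBoxDim Λ = upperBoxDim Λ ∧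
    upperBoxDim Λ = sF ∧
    dimH Λ = ENNReal.ofReal sF := by
  obtain ⟨hab', hmaps, -⟩ := hI
  have hab : a < b := lt_of_IOSC F hab' hmaps hiosc
  have hsF0 : 0 ≤ sF := hsF.1
  have htend : Tendsto (fun δ : ℝ => Real.log (coverNumber Λ δ) / -Real.log δ)
      (𝓝[>] 0) (𝓝 sF) := by
    refine tendsto_order.mpr ⟨fun t ht => ?_, fun t ht => ?_⟩
    · rcases lt_or_ge t 0 with ht0 | ht0
      · filter_upwards [tendsto_neg_log_nhdsGT_zero.eventually_gt_atTop 0] with δ hδ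
        exact ht0.trans_le (div_nonneg (Real.log_natCast_nonneg _) hδ.le)
      · obtain ⟨s, hts, hs⟩ := exists_between ht
        obtain ⟨ε, hε, h⟩ := (hsF.hasCoverBound hinj hab hmaps hiosc hΛ
          (ht0.trans_lt hts) hs).exists_le_coverNumber_mul hΛ.2.1
        exact eventually_lt_log_coverNumber_div hε hts h
    · obtain ⟨s, hs, hst⟩ := exists_between ht
      refine eventually_log_coverNumber_div_lt hΛ.2.1 hΛ.1 hst
        (C := m * ∑' n, cylSum F.f a b n s) ?_
      filter_upwards [Ioo_mem_nhdsGT (sub_pos.mpr hab)] with δ hδ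
      exact hΛ.coverNumber_mul_le hab hmaps (hsF0.trans hs.le)
        (hsF.summable_cylSum hinj hab hs) hδ.1 hδ.2
  refine ⟨htend.liminf_eq.trans htend.limsup_eq.symm, htend.limsup_eq, le_antisymm ?_ ?_⟩
  · refine le_of_forall_gt_imp_ge_of_dense fun c hc => ?_
    rcases eq_or_ne c ⊤ with rfl | hctop
    · exact le_top
    · rw [← ENNReal.ofReal_toReal hctop] at hc ⊢
      have hlt := (ENNReal.ofReal_lt_ofReal_iff_of_nonneg hsF0).mp hc
      exact hΛ.dimH_le hab' hmaps (hsF0.trans hlt.le) (hsF.summable_cylSum hinj hab hlt)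
  · refine le_of_forall_lt_imp_le_of_dense fun c hc => ?_
    have hctop : c ≠ ⊤ := (hc.trans_le le_top).ne
    rw [← ENNReal.ofReal_toReal hctop] at hc ⊢
    have hlt := (ENNReal.ofReal_lt_ofReal_iff_of_nonneg ENNReal.toReal_nonneg).mp hc
    rcases ENNReal.toReal_nonneg.eq_or_lt with h0 | hpos
    · rw [← h0, ENNReal.ofReal_zero]
      exact zero_le
    · exact le_dimH_of_hasCoverBound hΛ.2.1 hpos
        (hsF.hasCoverBound hinj hab hmaps hiosc hΛ hpos hlt)
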